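/- Let 2 < p ≤ 5 and 1 < γ₀ < min{2, p−1}, and let ε ∈ (0, γ₀−1). There exists a constant C > 0, depending only on p, ε and γ₀, such that for every smooth solution φ of the defocusing semilinear wave equation with E_{0,γ₀}[φ] < ∞ one has ∫₀^∞ ∫_{ℝ³} v₊^{γ₀−ε−1} |φ(t,x)|^{p+1} dx dt ≤ C · E_{0,γ₀}[φ]. -/

import Mathlib

open MeasureTheory Real
open scoped ENNReal InnerProductSpace

noncomputable section

/-- Three-dimensional Euclidean space. -/
abbrev E3 : Type := EuclideanSpace ℝ (Fin 3)

/-- Second derivative of `f` at `x` in the direction `v`. -/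
def der2 (f : E3 → ℝ) (x v : E3) : ℝ := fderiv ℝ (fun y => fderiv ℝ f y v) x v

/-- The (spatial) Laplacian on `ℝ³`. -/
def lap3 (f : E3 → ℝ) (x : E3) : ℝ :=
  ∑ i : Fin 3, der2 f x (EuclideanSpace.single i 1)

/-- First time derivative `∂_t φ`. -/
def dt1 (φ : ℝ → E3 → ℝ) (t : ℝ) (x : E3) : ℝ := deriv (fun s => φ s x) t

/-- Second time derivative `∂_t² φ`. -/
def dtt (φ : ℝ → E3 → ℝ) (t : ℝ) (x : E3) : ℝ := deriv (fun s => dt1 φ s x) t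

/-- `φ` is a smooth solution of the defocusing semilinear wave equation
`∂_t²φ − Δφ + |φ|^{p−1}φ = 0` on `[0,∞) × ℝ³`. -/
def IsNLWSolution (p : ℝ) (φ : ℝ → E3 → ℝ) : Prop :=
  ContDiff ℝ (⊤ : ℕ∞) (fun q : ℝ × E3 => φ q.1 q.2) ∧
    ∀ t : ℝ, 0 ≤ t → ∀ x : E3,
      dtt φ t x - lap3 (φ t) x + |φ t x| ^ (p - 1) * φ t x = 0

/-- The weighted initial energy `E_{k,γ₀}[φ]`. -/
def wEnergy (p : ℝ) (k : ℕ) (γ₀ : ℝ) (φ : ℝ → E3 → ℝ) : ℝ≥0∞ :=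
  (∑ l ∈ Finset.range (k + 1),
    ∫⁻ x : E3, ENNReal.ofReal ((1 + ‖x‖) ^ (γ₀ + 2 * (l : ℝ)) *
      (‖iteratedFDeriv ℝ (l + 1) (φ 0) x‖ ^ 2 + ‖iteratedFDeriv ℝ l (dt1 φ 0) x‖ ^ 2))) +
  ∫⁻ x : E3, ENNReal.ofReal ((1 + ‖x‖) ^ γ₀ * |φ 0 x| ^ (p + 1))

/-- `u₊ = √(1+((t−r)/2)²)`. -/
def uplus (t r : ℝ) : ℝ := Real.sqrt (1 + ((t - r) / 2) ^ 2)

/-- `v₊ = √(1+((t+r)/2)²)`. -/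
def vplus (t r : ℝ) : ℝ := Real.sqrt (1 + ((t + r) / 2) ^ 2)

/-- Surface measure on the unit sphere `S² ⊂ ℝ³` (total mass `4π`). -/
def sphereMeasure : Measure (Metric.sphere (0 : E3) 1) := (volume : Measure E3).toSphere

/-! ### The multiplier identity -/

/-- Pointwise energy density attached to the multiplier `F ∂_t φ + G (x·∇φ + φ)`. Here `a = ∂_t φ`,
`P = ∇φ`, `m = |x|⁻²` and `V` is the potential energy. -/
def dens (φ a F G m V : ℝ) (P x : Fin 3 → ℝ) : ℝ :=
  F / 2 * (a ^ 2 + ∑ j, P j ^ 2 + (2 * (∑ j, x j * P j) * φ + φ ^ 2) * m)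
    + G * a * (∑ j, x j * P j + φ) + F * V

/-- The `i`-th component of the flux that accompanies `dens`. -/
def flux (φ a F G m V : ℝ) (P x : Fin 3 → ℝ) (i : Fin 3) : ℝ :=
  -((F * a + G * (∑ j, x j * P j + φ)) * P i)
    + (G * ((∑ j, P j ^ 2) / 2 - a ^ 2 / 2 + V) - F * a * φ * m - G * φ ^ 2 * m / 2) * x i

/-- Directional derivative of `dens`. -/
def densD (φ a F G m V : ℝ) (P x : Fin 3 → ℝ) (φ' a' F' G' m' V' : ℝ) (P' x' : Fin 3 → ℝ) : ℝ :=
  F' / 2 * (a ^ 2 + ∑ j, P j ^ 2 + (2 * (∑ j, x j * P j) * φ + φ ^ 2) * m)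
    + F / 2 * (2 * a * a' + ∑ j, 2 * P j * P' j
      + ((2 * (∑ j, (x' j * P j + x j * P' j)) * φ + 2 * (∑ j, x j * P j) * φ' + 2 * φ * φ') * m
        + (2 * (∑ j, x j * P j) * φ + φ ^ 2) * m'))
    + ((G' * a + G * a') * (∑ j, x j * P j + φ)
      + G * a * (∑ j, (x' j * P j + x j * P' j) + φ')) + (F' * V + F * V')

/-- Directional derivative of `flux`. -/
def fluxD (φ a F G m V : ℝ) (P x : Fin 3 → ℝ) (φ' a' F' G' m' V' : ℝ) (P' x' : Fin 3 → ℝ)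
    (i : Fin 3) : ℝ :=
  -((F' * a + F * a' + (G' * (∑ j, x j * P j + φ)
      + G * (∑ j, (x' j * P j + x j * P' j) + φ'))) * P i
      + (F * a + G * (∑ j, x j * P j + φ)) * P' i)
    + ((G' * ((∑ j, P j ^ 2) / 2 - a ^ 2 / 2 + V)
        + G * ((∑ j, 2 * P j * P' j) / 2 - a * a' + V')
        - ((F' * a + F * a') * φ * m + F * a * φ' * m + F * a * φ * m')
        - (G' * φ ^ 2 * m + G * (2 * φ * φ') * m + G * φ ^ 2 * m') / 2) * x i
      + (G * ((∑ j, P j ^ 2) / 2 - a ^ 2 / 2 + V) - F * a * φ * m - G * φ ^ 2 * m / 2) * x' i)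

section Derivatives

variable {φ a F G m V : ℝ → ℝ} {P x : Fin 3 → ℝ → ℝ} {φ' a' F' G' m' V' : ℝ} {P' x' : Fin 3 → ℝ}
  {s : ℝ}

theorem hasDerivAt_dens (hφ : HasDerivAt φ φ' s) (ha : HasDerivAt a a' s) (hF : HasDerivAt F F' s)
    (hG : HasDerivAt G G' s) (hm : HasDerivAt m m' s) (hV : HasDerivAt V V' s)
    (hP : ∀ j, HasDerivAt (P j) (P' j) s) (hx : ∀ j, HasDerivAt (x j) (x' j) s) :
    HasDerivAt (fun s => dens (φ s) (a s) (F s) (G s) (m s) (V s) (fun j => P j s) fun j => x j s)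
      (densD (φ s) (a s) (F s) (G s) (m s) (V s) (fun j => P j s) (fun j => x j s)
        φ' a' F' G' m' V' P' x') s := by
  have hσ : HasDerivAt (fun s => ∑ j, x j s * P j s) (∑ j, (x' j * P j s + x j s * P' j)) s :=
    HasDerivAt.fun_sum fun j _ => (hx j).mul (hP j)
  have hN : HasDerivAt (fun s => ∑ j, P j s ^ 2) (∑ j, 2 * P j s * P' j) s :=
    HasDerivAt.fun_sum fun j _ => by simpa using (hP j).fun_pow 2
  have h := (((hF.div_const 2).mul (((ha.pow 2).add hN).add
    ((((hσ.const_mul 2).mul hφ).add (hφ.pow 2)).mul hm))).add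
    ((hG.mul ha).mul (hσ.add hφ))).add (hF.mul hV)
  refine h.congr_deriv ?_
  simp only [densD, Pi.add_apply, Pi.mul_apply, Pi.pow_apply]
  ring

theorem hasDerivAt_flux (hφ : HasDerivAt φ φ' s) (ha : HasDerivAt a a' s) (hF : HasDerivAt F F' s)
    (hG : HasDerivAt G G' s) (hm : HasDerivAt m m' s) (hV : HasDerivAt V V' s)
    (hP : ∀ j, HasDerivAt (P j) (P' j) s) (hx : ∀ j, HasDerivAt (x j) (x' j) s) (i : Fin 3) :
    HasDerivAt (fun s => flux (φ s) (a s) (F s) (G s) (m s) (V s) (fun j => P j s)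
        (fun j => x j s) i)
      (fluxD (φ s) (a s) (F s) (G s) (m s) (V s) (fun j => P j s) (fun j => x j s)
        φ' a' F' G' m' V' P' x' i) s := by
  have hσ : HasDerivAt (fun s => ∑ j, x j s * P j s) (∑ j, (x' j * P j s + x j s * P' j)) s :=
    HasDerivAt.fun_sum fun j _ => (hx j).mul (hP j)
  have hN : HasDerivAt (fun s => ∑ j, P j s ^ 2) (∑ j, 2 * P j s * P' j) s :=
    HasDerivAt.fun_sum fun j _ => by simpa using (hP j).fun_pow 2
  have h := ((((hF.mul ha).add (hG.mul (hσ.add hφ))).mul (hP i)).neg).add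
    ((((hG.mul (((hN.div_const 2).sub ((ha.pow 2).div_const 2)).add hV)).sub
      (((hF.mul ha).mul hφ).mul hm)).sub (((hG.mul (hφ.pow 2)).mul hm).div_const 2)).mul (hx i))
  refine h.congr_deriv ?_
  simp only [fluxD, Pi.add_apply, Pi.mul_apply, Pi.pow_apply, Pi.sub_apply]
  ring

end Derivatives

/-- The divergence identity behind the weighted energy estimate. -/
theorem densD_add_sum_fluxD {φ a F G m V Ft Gt F' G' Vd att p : ℝ} {P x A : Fin 3 → ℝ}
    {h : Fin 3 → Fin 3 → ℝ} (hsymm : ∀ i j, h i j = h j i) (hm : m * ∑ j, x j ^ 2 = 1)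
    (heq : att - ∑ i, h i i + Vd = 0) (hV : φ * Vd = (p + 1) * V) :
    densD φ a F G m V P x a att Ft Gt 0 (Vd * a) A 0
      + ∑ i, fluxD φ a F G m V P x (P i) (A i) (F' * x i) (G' * x i) (-2 * x i * m ^ 2)
          (Vd * P i) (fun j => h i j) (Pi.single i 1) i
    = (Ft - G - (∑ j, x j ^ 2) * G') * (a ^ 2 + m * (∑ j, x j * P j + φ) ^ 2) / 2
      + (Gt - F') * a * (∑ j, x j * P j + φ)
      + (∑ j, P j ^ 2 - m * (∑ j, x j * P j) ^ 2) * (Ft + (∑ j, x j ^ 2) * G' - G) / 2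
      + V * (Ft + (∑ j, x j ^ 2) * G' - (p - 2) * G) := by
  have h1 := hsymm 1 0
  have h2 := hsymm 2 0
  have h3 := hsymm 2 1
  simp only [densD, fluxD, Fin.sum_univ_three, Pi.single_apply, Pi.zero_apply] at *
  simp only [h1, h2, h3, Fin.isValue, Fin.reduceEq, if_true, if_false]
  linear_combination (F * a + G * (x 0 * P 0 + x 1 * P 1 + x 2 * P 2 + φ)) * heq - G * hV
    + (2 * F * a * φ * m - F' * a * φ + G * φ ^ 2 * m
      + G' * (x 0 * P 0 + x 1 * P 1 + x 2 * P 2) * (x 0 * P 0 + x 1 * P 1 + x 2 * P 2 + φ)) * hm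

theorem sum_mul_sq_le {r : ℝ} {P x : Fin 3 → ℝ} (hx : ∑ j, x j ^ 2 = r ^ 2) :
    (∑ j, x j * P j) ^ 2 ≤ r ^ 2 * ∑ j, P j ^ 2 :=
  hx ▸ Finset.sum_mul_sq_le_sq_mul_sq _ _ _

/-- The bulk term of the divergence identity is nonpositive for `F = f + g` and `G = (f - g) / r`,
where `f` depends on `v` only and `g_v ≤ 0`. Here `fv, gu, gv` stand for the null derivatives. -/
theorem bulk_nonpos {r φ a V p f g fv gu gv : ℝ} {P x : Fin 3 → ℝ} (hr : 0 < r)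
    (hx : ∑ j, x j ^ 2 = r ^ 2) (hV : 0 ≤ V) (hgv : gv ≤ 0)
    (h2 : (fv + gu) * r ≤ 2 * (f - g)) (hp : (fv + gu) * r ≤ (p - 1) * (f - g)) :
    ((fv + gu + gv) / 2 - (f - g) / r
        - (∑ j, x j ^ 2) * (((fv + gu - gv) / 2 / r - (f - g) / r ^ 2) / r))
        * (a ^ 2 + (r ^ 2)⁻¹ * (∑ j, x j * P j + φ) ^ 2) / 2
      + ((fv - gu - gv) / 2 / r - (fv - gu + gv) / 2 / r) * a * (∑ j, x j * P j + φ)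
      + (∑ j, P j ^ 2 - (r ^ 2)⁻¹ * (∑ j, x j * P j) ^ 2) * ((fv + gu + gv) / 2
        + (∑ j, x j ^ 2) * (((fv + gu - gv) / 2 / r - (f - g) / r ^ 2) / r) - (f - g) / r) / 2
      + V * ((fv + gu + gv) / 2
        + (∑ j, x j ^ 2) * (((fv + gu - gv) / 2 / r - (f - g) / r ^ 2) / r)
        - (p - 2) * ((f - g) / r)) ≤ 0 := by
  have hσ := sum_mul_sq_le (P := P) hx
  rw [hx]
  set σ := ∑ j, x j * P j
  set N := ∑ j, P j ^ 2
  have i1 : fv + gu - 2 * (f - g) / r ≤ 0 := by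
    rw [sub_nonpos, le_div_iff₀ hr]; exact h2
  have i2 : fv + gu - (p - 1) * (f - g) / r ≤ 0 := by
    rw [sub_nonpos, le_div_iff₀ hr]; exact hp
  have i3 : 0 ≤ N - (r ^ 2)⁻¹ * σ ^ 2 := by
    rw [sub_nonneg, inv_mul_le_iff₀ (by positivity)]; exact hσ
  have j1 := mul_nonpos_of_nonpos_of_nonneg hgv (sq_nonneg (a - (σ + φ) / r))
  have j2 := mul_nonpos_of_nonneg_of_nonpos i3 i1
  have j3 := mul_nonpos_of_nonneg_of_nonpos hV i2
  refine le_of_eq_of_le (b := gv / 2 * (a - (σ + φ) / r) ^ 2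
    + (N - (r ^ 2)⁻¹ * σ ^ 2) * (fv + gu - 2 * (f - g) / r) / 2
    + V * (fv + gu - (p - 1) * (f - g) / r)) ?_ (by linarith)
  field_simp
  ring

theorem le_dens {r φ a f g V : ℝ} {P x : Fin 3 → ℝ} (hr : 0 < r)
    (hx : ∑ j, x j ^ 2 = r ^ 2) (hf : 0 ≤ f) (hg : 0 ≤ g) :
    (f + g) * V ≤ dens φ a (f + g) ((f - g) / r) (r ^ 2)⁻¹ V P x := by
  have hσ := sum_mul_sq_le (P := P) hx
  unfold dens
  set σ := ∑ j, x j * P j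
  set N := ∑ j, P j ^ 2
  have i3 : 0 ≤ N - (r ^ 2)⁻¹ * σ ^ 2 := by
    rw [sub_nonneg, inv_mul_le_iff₀ (by positivity)]; exact hσ
  have j1 := mul_nonneg hf (sq_nonneg (a + (σ + φ) / r))
  have j2 := mul_nonneg hg (sq_nonneg (a - (σ + φ) / r))
  have j3 := mul_nonneg (add_nonneg hf hg) i3
  have : (f + g) / 2 * (a ^ 2 + N + (2 * σ * φ + φ ^ 2) * (r ^ 2)⁻¹)
      + (f - g) / r * a * (σ + φ) + (f + g) * V
      = (f * (a + (σ + φ) / r) ^ 2 + g * (a - (σ + φ) / r) ^ 2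
        + (f + g) * (N - (r ^ 2)⁻¹ * σ ^ 2)) / 2 + (f + g) * V := by
    field_simp
    ring
  linarith

theorem dens_zero_le {r φ a F V : ℝ} {P x : Fin 3 → ℝ} (hr : 0 < r)
    (hx : ∑ j, x j ^ 2 = r ^ 2) (hF : 0 ≤ F) :
    dens φ a F 0 (r ^ 2)⁻¹ V P x
      ≤ F * (a ^ 2 + ∑ j, P j ^ 2 + φ ^ 2 / r ^ 2 + V) := by
  have hσ := sum_mul_sq_le (P := P) hx
  unfold dens
  set σ := ∑ j, x j * P j
  set N := ∑ j, P j ^ 2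
  have i3 : 0 ≤ N - (r ^ 2)⁻¹ * σ ^ 2 := by
    rw [sub_nonneg, inv_mul_le_iff₀ (by positivity)]; exact hσ
  have i4 : 0 ≤ (r ^ 2)⁻¹ * (σ - φ) ^ 2 := by positivity
  have : F / 2 * (a ^ 2 + N + (2 * σ * φ + φ ^ 2) * (r ^ 2)⁻¹) + 0 * a * (σ + φ) + F * V
      = F * (a ^ 2 / 2 + N / 2 + ((2 * σ * φ + φ ^ 2) * (r ^ 2)⁻¹) / 2 + V) := by ring
  rw [this]
  refine mul_le_mul_of_nonneg_left ?_ hF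
  have : φ ^ 2 / r ^ 2 = φ ^ 2 * (r ^ 2)⁻¹ := by ring
  nlinarith [sq_nonneg a]

/-- Radial flux through small spheres is bounded above, up to a factor `r`, by a locally bounded
quantity. -/
theorem sum_flux_mul_le {r φ a f g V : ℝ} {P x : Fin 3 → ℝ} (hr : 0 < r)
    (hx : ∑ j, x j ^ 2 = r ^ 2) (hfg : g ≤ f) :
    ∑ i, flux φ a (f + g) ((f - g) / r) (r ^ 2)⁻¹ V P x i * x i
      ≤ |f + g| * |a| * (|∑ j, x j * P j| + |φ|)
        + r * (f - g) * ((∑ j, P j ^ 2) / 2 + |V|) := by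
  have e : ∑ i, flux φ a (f + g) ((f - g) / r) (r ^ 2)⁻¹ V P x i * x i
      = -((f + g) * a * (∑ j, x j * P j + φ))
        + r * (f - g) * ((∑ j, P j ^ 2) / 2 + V)
        - (f - g) / r * (r ^ 2 * a ^ 2 / 2 + (∑ j, x j * P j) * (∑ j, x j * P j + φ)
          + φ ^ 2 / 2) := by
    have e1 : ∀ c : ℝ, ∑ i, c * x i * x i = c * r ^ 2 := fun c => by
      rw [← hx, Finset.mul_sum]; exact Finset.sum_congr rfl fun i _ => by ring
    have e2 : ∀ c : ℝ, ∑ i, -(c * P i) * x i = -(c * ∑ i, x i * P i) := fun c => by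
      rw [Finset.mul_sum, ← Finset.sum_neg_distrib]
      exact Finset.sum_congr rfl fun i _ => by ring
    simp only [flux]
    rw [Finset.sum_congr rfl fun i _ => add_mul _ _ _, Finset.sum_add_distrib, e1, e2]
    field_simp
    ring
  rw [e]
  set σ := ∑ j, x j * P j
  set N := ∑ j, P j ^ 2
  have h1 : 0 ≤ (f - g) / r := div_nonneg (sub_nonneg.2 hfg) hr.le
  have h2 : 0 ≤ (f - g) / r * (r ^ 2 * a ^ 2 / 2 + σ * (σ + φ) + φ ^ 2 / 2) :=
    mul_nonneg h1 (by nlinarith [sq_nonneg (σ + φ), sq_nonneg σ, sq_nonneg (r * a)])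
  have h3 : -((f + g) * a * (σ + φ)) ≤ |f + g| * |a| * (|σ| + |φ|) := by
    refine (neg_le_abs _).trans ?_
    rw [abs_mul, abs_mul]
    gcongr
    exact abs_add_le _ _
  have h4 : r * (f - g) * (N / 2 + V) ≤ r * (f - g) * (N / 2 + |V|) := by
    have := sub_nonneg.2 hfg
    gcongr
    exact le_abs_self V
  linarith

/-! ### Spacetime fields -/

/-- The time direction in `ℝ × ℝ³`. -/
def dirT : ℝ × E3 := (1, 0)

/-- The `i`-th spatial direction in `ℝ × ℝ³`. -/
def dirX (i : Fin 3) : ℝ × E3 := (0, EuclideanSpace.single i 1)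

/-- Derivative in a fixed direction. -/
def pd (w : ℝ × E3) (Φ : ℝ × E3 → ℝ) (q : ℝ × E3) : ℝ := fderiv ℝ Φ q w

theorem contDiff_pd {Φ : ℝ × E3 → ℝ} (hΦ : ContDiff ℝ (⊤ : ℕ∞) Φ) (w : ℝ × E3) :
    ContDiff ℝ (⊤ : ℕ∞) (pd w Φ) :=
  (hΦ.fderiv_right (m := (⊤ : ℕ∞)) (by simp)).clm_apply contDiff_const

theorem hasDerivAt_line {Φ : ℝ × E3 → ℝ} {q : ℝ × E3} (hΦ : DifferentiableAt ℝ Φ q) (w : ℝ × E3) :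
    HasDerivAt (fun s : ℝ => Φ (q + s • w)) (pd w Φ q) 0 :=
  hΦ.hasFDerivAt.hasLineDerivAt w

theorem pd_comm {Φ : ℝ × E3 → ℝ} (hΦ : ContDiff ℝ (⊤ : ℕ∞) Φ) (w z : ℝ × E3) (q : ℝ × E3) :
    pd w (pd z Φ) q = pd z (pd w Φ) q := by
  have hd : DifferentiableAt ℝ (fderiv ℝ Φ) q :=
    ((hΦ.fderiv_right (m := (⊤ : ℕ∞)) (by simp)).differentiable (by simp)) q
  have h : ∀ a b : ℝ × E3, pd a (pd b Φ) q = fderiv ℝ (fderiv ℝ Φ) q a b := by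
    intro a b
    unfold pd
    rw [fderiv_clm_apply hd (differentiableAt_const b)]
    simp
  rw [h, h]
  exact (hΦ.contDiffAt.isSymmSndFDerivAt
    (by simpa using WithTop.coe_le_coe.2 (le_top : (2 : ℕ∞) ≤ ⊤))) w z

theorem pd_dirT {Φ : ℝ × E3 → ℝ} {t : ℝ} {x : E3} (hΦ : DifferentiableAt ℝ Φ (t, x)) :
    deriv (fun s => Φ (s, x)) t = pd dirT Φ (t, x) := by
  have h : HasDerivAt (fun s : ℝ => ((s, x) : ℝ × E3)) dirT t :=
    (hasDerivAt_id t).prodMk (hasDerivAt_const t x)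
  exact (hΦ.hasFDerivAt.comp_hasDerivAt t h).deriv

theorem fderiv_slice {Φ : ℝ × E3 → ℝ} {t : ℝ} {x : E3} (hΦ : DifferentiableAt ℝ Φ (t, x))
    (v : E3) : fderiv ℝ (fun y => Φ (t, y)) x v = pd (0, v) Φ (t, x) := by
  have h : HasFDerivAt (fun y : E3 => ((t, y) : ℝ × E3)) (ContinuousLinearMap.inr ℝ ℝ E3) x :=
    hasFDerivAt_prodMk_right t x
  have h2 := (hΦ.hasFDerivAt.comp x h).fderiv
  simp only [Function.comp_def] at h2
  rw [h2]
  rfl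

theorem IsNLWSolution.eq_zero {p : ℝ} {φ : ℝ → E3 → ℝ} (h : IsNLWSolution p φ) {q : ℝ × E3}
    (hq : 0 ≤ q.1) :
    pd dirT (pd dirT fun q => φ q.1 q.2) q
      - ∑ i, pd (dirX i) (pd (dirX i) fun q => φ q.1 q.2) q
      + |φ q.1 q.2| ^ (p - 1) * φ q.1 q.2 = 0 := by
  obtain ⟨t, x⟩ := q
  set Φ : ℝ × E3 → ℝ := fun q => φ q.1 q.2 with hΦdef
  have hΦ : ContDiff ℝ (⊤ : ℕ∞) Φ := h.1
  have hd : Differentiable ℝ Φ := hΦ.differentiable (by simp)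
  have h1 : ∀ t x, dt1 φ t x = pd dirT Φ (t, x) := fun t x => pd_dirT (Φ := Φ) (hd _)
  have h2 : dtt φ t x = pd dirT (pd dirT Φ) (t, x) := by
    unfold dtt
    simp only [h1]
    exact pd_dirT (((contDiff_pd hΦ _).differentiable (by simp)) _)
  have h3 : lap3 (φ t) x = ∑ i, pd (dirX i) (pd (dirX i) Φ) (t, x) := by
    unfold lap3 der2
    refine Finset.sum_congr rfl fun i _ => ?_
    have h4 : ∀ y, fderiv ℝ (φ t) y (EuclideanSpace.single i 1) = pd (dirX i) Φ (t, y) :=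
      fun y => fderiv_slice (Φ := Φ) (hd _) _
    simp only [h4]
    exact fderiv_slice (((contDiff_pd hΦ _).differentiable (by simp)) _) _
  have := h.2 t hq x
  rw [h2, h3] at this
  exact this

/-- Conditions on the weights `f(v)`, `k(u)` and the cutoff `χ(v)` under which the multiplier
`f(v)χ(v) ∂_v + k(u)χ(v) ∂_u` has a nonpositive bulk term. -/
structure AdmissibleWeights (p : ℝ) (f k χ : ℝ → ℝ) : Prop where
  contDiff_f : ContDiff ℝ 1 f
  contDiff_k : ContDiff ℝ 1 k
  contDiff_χ : ContDiff ℝ 1 χ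
  f_nonneg : ∀ v, 0 ≤ v → 0 ≤ f v
  k_nonneg : ∀ u, 0 ≤ k u
  χ_nonneg : ∀ v, 0 ≤ χ v
  deriv_χ_nonpos : ∀ v, deriv χ v ≤ 0
  k_le_f : ∀ u v, 0 ≤ u + v → u ≤ v → k u ≤ f v
  deriv_le_two : ∀ u v, 0 ≤ u + v → u ≤ v →
    (deriv f v + deriv k u) * (v - u) ≤ 2 * (f v - k u)
  deriv_le : ∀ u v, 0 ≤ u + v → u ≤ v →
    (deriv f v + deriv k u) * (v - u) ≤ (p - 1) * (f v - k u)

/-- The outgoing weight `f(v) χ(v)` in terms of `t` and `r`. -/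
def outW (f χ : ℝ → ℝ) (t r : ℝ) : ℝ := f ((t + r) / 2) * χ ((t + r) / 2)

/-- The incoming weight `k(u) χ(v)` in terms of `t` and `r`. -/
def inW (k χ : ℝ → ℝ) (t r : ℝ) : ℝ := k ((t - r) / 2) * χ ((t + r) / 2)

/-- The weighted energy density of `Φ`. -/
def enD (p : ℝ) (f k χ : ℝ → ℝ) (Φ : ℝ × E3 → ℝ) (q : ℝ × E3) : ℝ :=
  dens (Φ q) (pd dirT Φ q) (outW f χ q.1 ‖q.2‖ + inW k χ q.1 ‖q.2‖)
    ((outW f χ q.1 ‖q.2‖ - inW k χ q.1 ‖q.2‖) / ‖q.2‖) (‖q.2‖ ^ 2)⁻¹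
    (|Φ q| ^ (p + 1) / (p + 1)) (fun j => pd (dirX j) Φ q) fun j => q.2 j

/-- The weighted energy flux of `Φ`. -/
def enJ (p : ℝ) (f k χ : ℝ → ℝ) (Φ : ℝ × E3 → ℝ) (i : Fin 3) (q : ℝ × E3) : ℝ :=
  flux (Φ q) (pd dirT Φ q) (outW f χ q.1 ‖q.2‖ + inW k χ q.1 ‖q.2‖)
    ((outW f χ q.1 ‖q.2‖ - inW k χ q.1 ‖q.2‖) / ‖q.2‖) (‖q.2‖ ^ 2)⁻¹
    (|Φ q| ^ (p + 1) / (p + 1)) (fun j => pd (dirX j) Φ q) (fun j => q.2 j) i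

theorem E3.sum_sq (x : E3) : ∑ j, x j ^ 2 = ‖x‖ ^ 2 := by
  rw [EuclideanSpace.norm_sq_eq]; simp

section Regularity

variable {p : ℝ} {f k χ : ℝ → ℝ} {Φ : ℝ × E3 → ℝ}

theorem contDiff_potential (hp : 2 < p) (hΦ : ContDiff ℝ (⊤ : ℕ∞) Φ) :
    ContDiff ℝ 1 fun q => |Φ q| ^ (p + 1) / (p + 1) :=
  ((hΦ.of_le (by exact_mod_cast le_top)).norm_rpow (p := p + 1) (by linarith)).div_const _

theorem contDiffAt_snd_norm {q : ℝ × E3} (hq : q.2 ≠ 0) :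
    ContDiffAt ℝ 1 (fun q : ℝ × E3 => ‖q.2‖) q :=
  contDiffAt_snd.norm ℝ hq

theorem contDiffAt_outW (hf : ContDiff ℝ 1 f) (hχ : ContDiff ℝ 1 χ) {q : ℝ × E3} (hq : q.2 ≠ 0) :
    ContDiffAt ℝ 1 (fun q : ℝ × E3 => outW f χ q.1 ‖q.2‖) q := by
  have h : ContDiffAt ℝ 1 (fun q : ℝ × E3 => (q.1 + ‖q.2‖) / 2) q :=
    (contDiffAt_fst.add (contDiffAt_snd_norm hq)).div_const 2
  exact (hf.contDiffAt.comp q h).mul (hχ.contDiffAt.comp q h)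

theorem contDiffAt_inW (hk : ContDiff ℝ 1 k) (hχ : ContDiff ℝ 1 χ) {q : ℝ × E3} (hq : q.2 ≠ 0) :
    ContDiffAt ℝ 1 (fun q : ℝ × E3 => inW k χ q.1 ‖q.2‖) q := by
  have h : ContDiffAt ℝ 1 (fun q : ℝ × E3 => (q.1 + ‖q.2‖) / 2) q :=
    (contDiffAt_fst.add (contDiffAt_snd_norm hq)).div_const 2
  have h' : ContDiffAt ℝ 1 (fun q : ℝ × E3 => (q.1 - ‖q.2‖) / 2) q :=
    (contDiffAt_fst.sub (contDiffAt_snd_norm hq)).div_const 2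
  exact (hk.contDiffAt.comp q h').mul (hχ.contDiffAt.comp q h)

theorem contDiff_coord (j : Fin 3) : ContDiff ℝ 1 fun q : ℝ × E3 => q.2 j :=
  (EuclideanSpace.proj j : E3 →L[ℝ] ℝ).contDiff.comp contDiff_snd

theorem contDiffAt_enD (hw : AdmissibleWeights p f k χ) (hp : 2 < p)
    (hΦ : ContDiff ℝ (⊤ : ℕ∞) Φ) {q : ℝ × E3} (hq : q.2 ≠ 0) :
    ContDiffAt ℝ 1 (enD p f k χ Φ) q := by
  have h1 := contDiffAt_outW hw.contDiff_f hw.contDiff_χ hq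
  have h2 := contDiffAt_inW hw.contDiff_k hw.contDiff_χ hq
  have h3 := contDiffAt_snd_norm hq
  have h4 : ∀ w, ContDiffAt ℝ 1 (pd w Φ) q := fun w =>
    ((contDiff_pd hΦ w).of_le (by exact_mod_cast le_top)).contDiffAt
  have h5 : ContDiffAt ℝ 1 Φ q := (hΦ.of_le (by exact_mod_cast le_top)).contDiffAt
  have h6 := (contDiff_potential hp hΦ).contDiffAt (x := q)
  have h7 : ∀ j, ContDiffAt ℝ 1 (fun q : ℝ × E3 => q.2 j) q := fun j =>
    (contDiff_coord j).contDiffAt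
  have h8 : ‖q.2‖ ≠ 0 := norm_ne_zero_iff.2 hq
  have h9 : ContDiffAt ℝ 1 (fun q : ℝ × E3 => (‖q.2‖ ^ 2)⁻¹) q :=
    (h3.pow 2).inv (pow_ne_zero 2 h8)
  have h10 := (h1.sub h2).div h3 h8
  have h11 : ContDiffAt ℝ 1 (fun q : ℝ × E3 => ∑ j, q.2 j * pd (dirX j) Φ q) q :=
    ContDiffAt.sum fun j _ => (h7 j).mul (h4 _)
  have h12 : ContDiffAt ℝ 1 (fun q : ℝ × E3 => ∑ j, pd (dirX j) Φ q ^ 2) q :=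
    ContDiffAt.sum fun j _ => (h4 _).pow 2
  exact ((((h1.add h2).div_const 2).mul ((((h4 dirT).pow 2).add h12).add
    ((((contDiffAt_const (c := (2 : ℝ))).mul h11).mul h5 |>.add (h5.pow 2)).mul h9))).add
    ((h10.mul (h4 dirT)).mul (h11.add h5))).add ((h1.add h2).mul h6)

theorem contDiffAt_enJ (hw : AdmissibleWeights p f k χ) (hp : 2 < p)
    (hΦ : ContDiff ℝ (⊤ : ℕ∞) Φ) (i : Fin 3) {q : ℝ × E3} (hq : q.2 ≠ 0) :
    ContDiffAt ℝ 1 (enJ p f k χ Φ i) q := by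
  have h1 := contDiffAt_outW hw.contDiff_f hw.contDiff_χ hq
  have h2 := contDiffAt_inW hw.contDiff_k hw.contDiff_χ hq
  have h3 := contDiffAt_snd_norm hq
  have h4 : ∀ w, ContDiffAt ℝ 1 (pd w Φ) q := fun w =>
    ((contDiff_pd hΦ w).of_le (by exact_mod_cast le_top)).contDiffAt
  have h5 : ContDiffAt ℝ 1 Φ q := (hΦ.of_le (by exact_mod_cast le_top)).contDiffAt
  have h6 := (contDiff_potential hp hΦ).contDiffAt (x := q)
  have h7 : ∀ j, ContDiffAt ℝ 1 (fun q : ℝ × E3 => q.2 j) q := fun j =>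
    (contDiff_coord j).contDiffAt
  have h8 : ‖q.2‖ ≠ 0 := norm_ne_zero_iff.2 hq
  have h9 : ContDiffAt ℝ 1 (fun q : ℝ × E3 => (‖q.2‖ ^ 2)⁻¹) q :=
    (h3.pow 2).inv (pow_ne_zero 2 h8)
  have h10 := (h1.sub h2).div h3 h8
  have h11 : ContDiffAt ℝ 1 (fun q : ℝ × E3 => ∑ j, q.2 j * pd (dirX j) Φ q) q :=
    ContDiffAt.sum fun j _ => (h7 j).mul (h4 _)
  have h12 : ContDiffAt ℝ 1 (fun q : ℝ × E3 => ∑ j, pd (dirX j) Φ q ^ 2) q :=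
    ContDiffAt.sum fun j _ => (h4 _).pow 2
  exact ((((h1.add h2).mul (h4 dirT)).add (h10.mul (h11.add h5))).mul (h4 (dirX i))).neg.add
    ((((h10.mul (((h12.div_const 2).sub (((h4 dirT).pow 2).div_const 2)).add h6)).sub
      ((((h1.add h2).mul (h4 dirT)).mul h5).mul h9)).sub
      (((h10.mul (h5.pow 2)).mul h9).div_const 2)).mul (h7 i))

end Regularity

/-! ### The divergence inequality -/

section Weights

variable {f k χ : ℝ → ℝ} {t r : ℝ → ℝ} {t' r' s : ℝ}

theorem hasDerivAt_outW (hf : ContDiff ℝ 1 f) (hχ : ContDiff ℝ 1 χ) (ht : HasDerivAt t t' s)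
    (hr : HasDerivAt r r' s) :
    HasDerivAt (fun s => outW f χ (t s) (r s))
      ((deriv f ((t s + r s) / 2) * χ ((t s + r s) / 2)
        + f ((t s + r s) / 2) * deriv χ ((t s + r s) / 2)) * ((t' + r') / 2)) s := by
  have hv : HasDerivAt (fun s => (t s + r s) / 2) ((t' + r') / 2) s := (ht.add hr).div_const 2
  have h1 := ((hf.differentiable (by simp)) ((t s + r s) / 2)).hasDerivAt.comp s hv
  have h2 := ((hχ.differentiable (by simp)) ((t s + r s) / 2)).hasDerivAt.comp s hv
  refine (h1.mul h2).congr_deriv ?_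
  simp only [Function.comp]
  ring

theorem hasDerivAt_inW (hk : ContDiff ℝ 1 k) (hχ : ContDiff ℝ 1 χ) (ht : HasDerivAt t t' s)
    (hr : HasDerivAt r r' s) :
    HasDerivAt (fun s => inW k χ (t s) (r s))
      (deriv k ((t s - r s) / 2) * χ ((t s + r s) / 2) * ((t' - r') / 2)
        + k ((t s - r s) / 2) * deriv χ ((t s + r s) / 2) * ((t' + r') / 2)) s := by
  have hv : HasDerivAt (fun s => (t s + r s) / 2) ((t' + r') / 2) s := (ht.add hr).div_const 2
  have hu : HasDerivAt (fun s => (t s - r s) / 2) ((t' - r') / 2) s := (ht.sub hr).div_const 2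
  have h1 := ((hk.differentiable (by simp)) ((t s - r s) / 2)).hasDerivAt.comp s hu
  have h2 := ((hχ.differentiable (by simp)) ((t s + r s) / 2)).hasDerivAt.comp s hv
  refine (h1.mul h2).congr_deriv ?_
  simp only [Function.comp]
  ring

end Weights

theorem hasDerivAt_norm_line {x : E3} (hx : x ≠ 0) (i : Fin 3) :
    HasDerivAt (fun s : ℝ => ‖x + s • (EuclideanSpace.single i 1 : E3)‖) (x i / ‖x‖) 0 := by
  have h1 : HasDerivAt (fun s : ℝ => x + s • (EuclideanSpace.single i 1 : E3))
      (EuclideanSpace.single i 1) 0 := by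
    simpa using ((hasDerivAt_id (0 : ℝ)).smul_const (EuclideanSpace.single i 1 : E3)).const_add x
  have h2 := h1.norm_sq
  have h3 := h2.sqrt (by simpa using hx)
  simp only [Real.sqrt_sq (norm_nonneg _)] at h3
  refine h3.congr_deriv ?_
  simp [EuclideanSpace.inner_single_right]
  field_simp

theorem hasDerivAt_coord_line (x : E3) (i j : Fin 3) :
    HasDerivAt (fun s : ℝ => (x + s • (EuclideanSpace.single i 1 : E3)) j)
      ((Pi.single i 1 : Fin 3 → ℝ) j) 0 := by
  have := ((hasDerivAt_id (0 : ℝ)).mul_const ((Pi.single i 1 : Fin 3 → ℝ) j)).const_add (x j)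
  simpa [Pi.single_apply] using this

theorem hasDerivAt_potential {p : ℝ} (hp : 2 < p) (y : ℝ) :
    HasDerivAt (fun y => |y| ^ (p + 1) / (p + 1)) (|y| ^ (p - 1) * y) y := by
  refine ((hasDerivAt_abs_rpow y (p := p + 1) (by linarith)).div_const (p + 1)).congr_deriv ?_
  rw [show p + 1 - 2 = p - 1 by ring]
  field_simp

theorem mul_deriv_potential {p : ℝ} (hp : 2 < p) (y : ℝ) :
    y * (|y| ^ (p - 1) * y) = (p + 1) * (|y| ^ (p + 1) / (p + 1)) := by
  rw [mul_div_cancel₀ _ (by linarith : p + 1 ≠ 0)]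
  rcases eq_or_ne y 0 with rfl | hy
  · rw [abs_zero, Real.zero_rpow (by linarith : p + 1 ≠ 0)]; simp
  · have h : |y| ^ (p + 1) = |y| ^ (p - 1) * |y| ^ (2 : ℕ) := by
      rw [← Real.rpow_natCast, ← Real.rpow_add (abs_pos.2 hy)]; norm_num; ring_nf
    rw [h, sq_abs]
    ring

theorem pd_enD_add_sum_pd_enJ_nonpos {p : ℝ} {f k χ : ℝ → ℝ} {Φ : ℝ × E3 → ℝ}
    (hw : AdmissibleWeights p f k χ) (hp : 2 < p)
    (hΦ : ContDiff ℝ (⊤ : ℕ∞) Φ) {q : ℝ × E3} (hq : q.2 ≠ 0) (ht : 0 ≤ q.1)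
    (heq : pd dirT (pd dirT Φ) q - ∑ i, pd (dirX i) (pd (dirX i) Φ) q
      + |Φ q| ^ (p - 1) * Φ q = 0) :
    pd dirT (enD p f k χ Φ) q + ∑ i, pd (dirX i) (enJ p f k χ Φ i) q ≤ 0 := by
  have hr : 0 < ‖q.2‖ := norm_pos_iff.2 hq
  have hd : ∀ Ψ : ℝ × E3 → ℝ, ContDiff ℝ (⊤ : ℕ∞) Ψ → ∀ w,
      HasDerivAt (fun s : ℝ => Ψ (q + s • w)) (pd w Ψ q) 0 := fun Ψ h w =>
    hasDerivAt_line ((h.differentiable (by simp)) q) w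
  have q0 : ∀ w : ℝ × E3, q + (0 : ℝ) • w = q := fun w => by simp
  have hVd : ∀ w : ℝ × E3, HasDerivAt (fun s : ℝ => |Φ (q + s • w)| ^ (p + 1) / (p + 1))
      (|Φ q| ^ (p - 1) * Φ q * pd w Φ q) 0 := fun w => by
    have h := hasDerivAt_potential hp (Φ (q + (0 : ℝ) • w))
    have h2 := h.comp (0 : ℝ) (hd Φ hΦ w)
    rw [q0] at h2
    exact h2
  set v := (q.1 + ‖q.2‖) / 2 with hv
  set u := (q.1 - ‖q.2‖) / 2 with hu
  set fv := deriv f v * χ v + f v * deriv χ v with hfv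
  set gu := deriv k u * χ v with hgu
  set gv := k u * deriv χ v with hgv
  set F := outW f χ q.1 ‖q.2‖ with hF
  set g := inW k χ q.1 ‖q.2‖ with hg
  -- the time derivative
  have hT : HasDerivAt (fun s : ℝ => enD p f k χ Φ (q + s • dirT))
      (densD (Φ q) (pd dirT Φ q) (F + g) ((F - g) / ‖q.2‖) (‖q.2‖ ^ 2)⁻¹
        (|Φ q| ^ (p + 1) / (p + 1)) (fun j => pd (dirX j) Φ q) (fun j => q.2 j)
        (pd dirT Φ q) (pd dirT (pd dirT Φ) q) ((fv + gu + gv) / 2)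
        ((fv - gu - gv) / 2 / ‖q.2‖) 0 (|Φ q| ^ (p - 1) * Φ q * pd dirT Φ q)
        (fun j => pd dirT (pd (dirX j) Φ) q) 0) 0 := by
    have ht1 : HasDerivAt (fun s : ℝ => (q + s • dirT).1) 1 0 := by
      simpa [dirT] using (hasDerivAt_id (0 : ℝ)).const_add q.1
    have hr1 : HasDerivAt (fun s : ℝ => ‖(q + s • dirT).2‖) 0 0 := by
      simpa [dirT] using hasDerivAt_const (0 : ℝ) ‖q.2‖
    have h1 := hasDerivAt_outW hw.contDiff_f hw.contDiff_χ ht1 hr1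
    have h2 := hasDerivAt_inW hw.contDiff_k hw.contDiff_χ ht1 hr1
    have h3 := hasDerivAt_dens (s := 0) (hd Φ hΦ dirT) (hd _ (contDiff_pd hΦ dirT) dirT)
      ((h1.fun_add h2).congr_deriv (f' := _) (g' := (fv + gu + gv) / 2) ?_)
      (((h1.fun_sub h2).fun_div hr1 (by rw [q0]; exact hr.ne')).congr_deriv
        (g' := (fv - gu - gv) / 2 / ‖q.2‖) ?_)
      ((hr1.fun_pow 2).fun_inv (by rw [q0]; positivity) |>.congr_deriv (g' := 0) (by simp)) (hVd dirT)
      (fun j => hd _ (contDiff_pd hΦ (dirX j)) dirT)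
      (x := fun j s => (q + s • dirT).2 j) (x' := 0)
      (fun j => by simpa [dirT] using hasDerivAt_const (0 : ℝ) (q.2 j))
    · simp only [q0] at h3
      exact h3
    · simp only [q0, hfv, hgu, hgv, hv, hu]
      ring
    · simp only [q0, hfv, hgu, hgv, hv, hu]
      field_simp
      ring
  have hX : ∀ i, HasDerivAt (fun s : ℝ => enJ p f k χ Φ i (q + s • dirX i))
      (fluxD (Φ q) (pd dirT Φ q) (F + g) ((F - g) / ‖q.2‖) (‖q.2‖ ^ 2)⁻¹
        (|Φ q| ^ (p + 1) / (p + 1)) (fun j => pd (dirX j) Φ q) (fun j => q.2 j)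
        (pd (dirX i) Φ q) (pd dirT (pd (dirX i) Φ) q) ((fv - gu + gv) / 2 / ‖q.2‖ * q.2 i)
        (((fv + gu - gv) / 2 / ‖q.2‖ - (F - g) / ‖q.2‖ ^ 2) / ‖q.2‖ * q.2 i)
        (-2 * q.2 i * ((‖q.2‖ ^ 2)⁻¹) ^ 2) (|Φ q| ^ (p - 1) * Φ q * pd (dirX i) Φ q)
        (fun j => pd (dirX i) (pd (dirX j) Φ) q) (Pi.single i 1) i) 0 := by
    intro i
    have ht1 : HasDerivAt (fun s : ℝ => (q + s • dirX i).1) 0 0 := by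
      simpa [dirX] using hasDerivAt_const (0 : ℝ) q.1
    have hr1 : HasDerivAt (fun s : ℝ => ‖(q + s • dirX i).2‖) (q.2 i / ‖q.2‖) 0 :=
      hasDerivAt_norm_line hq i
    have h1 := hasDerivAt_outW hw.contDiff_f hw.contDiff_χ ht1 hr1
    have h2 := hasDerivAt_inW hw.contDiff_k hw.contDiff_χ ht1 hr1
    have h3 := hasDerivAt_flux (s := 0) (hd Φ hΦ (dirX i))
      ((hd _ (contDiff_pd hΦ dirT) (dirX i)).congr_deriv (pd_comm hΦ _ _ _))
      ((h1.fun_add h2).congr_deriv (f' := _) (g' := (fv - gu + gv) / 2 / ‖q.2‖ * q.2 i) ?_)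
      (((h1.fun_sub h2).fun_div hr1 (by rw [q0]; exact hr.ne')).congr_deriv
        (g' := ((fv + gu - gv) / 2 / ‖q.2‖ - (F - g) / ‖q.2‖ ^ 2) / ‖q.2‖ * q.2 i) ?_)
      (((hr1.fun_pow 2).fun_inv (by rw [q0]; positivity)).congr_deriv
        (g' := -2 * q.2 i * ((‖q.2‖ ^ 2)⁻¹) ^ 2) ?_) (hVd (dirX i))
      (fun j => hd _ (contDiff_pd hΦ (dirX j)) (dirX i))
      (x := fun j s => (q + s • dirX i).2 j) (x' := Pi.single i 1)
      (fun j => hasDerivAt_coord_line q.2 i j) i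
    · simp only [q0] at h3
      exact h3
    · simp only [q0, hfv, hgu, hgv, hv, hu]
      ring
    · simp only [q0, hfv, hgu, hgv, hv, hu, ← hF, ← hg]
      field_simp
      ring
    · simp only [q0]
      field_simp
      simp
      ring
  have hdT : DifferentiableAt ℝ (enD p f k χ Φ) q :=
    (contDiffAt_enD hw hp hΦ hq).differentiableAt (by simp)
  have hdX : ∀ i, DifferentiableAt ℝ (enJ p f k χ Φ i) q := fun i =>
    (contDiffAt_enJ hw hp hΦ i hq).differentiableAt (by simp)
  rw [(hasDerivAt_line hdT dirT).unique hT,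
    Finset.sum_congr rfl fun i _ => (hasDerivAt_line (hdX i) (dirX i)).unique (hX i)]
  have hsq := E3.sum_sq q.2
  have hdiv := densD_add_sum_fluxD (φ := Φ q) (a := pd dirT Φ q) (F := F + g)
    (G := (F - g) / ‖q.2‖) (m := (‖q.2‖ ^ 2)⁻¹) (V := |Φ q| ^ (p + 1) / (p + 1))
    (Ft := (fv + gu + gv) / 2) (Gt := (fv - gu - gv) / 2 / ‖q.2‖)
    (F' := (fv - gu + gv) / 2 / ‖q.2‖)
    (G' := ((fv + gu - gv) / 2 / ‖q.2‖ - (F - g) / ‖q.2‖ ^ 2) / ‖q.2‖)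
    (Vd := |Φ q| ^ (p - 1) * Φ q) (att := pd dirT (pd dirT Φ) q) (p := p)
    (P := fun j => pd (dirX j) Φ q) (x := fun j => q.2 j)
    (A := fun j => pd dirT (pd (dirX j) Φ) q) (h := fun i j => pd (dirX i) (pd (dirX j) Φ) q)
    (fun i j => pd_comm hΦ _ _ _) (by rw [hsq]; field_simp) heq (mul_deriv_potential hp _)
  rw [hdiv]
  have huv : 0 ≤ u + v := by rw [hu, hv]; linarith
  have huv' : u ≤ v := by rw [hu, hv]; linarith
  have hvu : v - u = ‖q.2‖ := by rw [hu, hv]; ring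
  have hv0 : 0 ≤ v := by linarith
  have hχ := hw.χ_nonneg v
  have hχ' := hw.deriv_χ_nonpos v
  have hFg : F - g = χ v * (f v - k u) := by simp only [hF, hg, outW, inW, ← hv, ← hu]; ring
  have key : ∀ c, (deriv f v + deriv k u) * (v - u) ≤ c * (f v - k u) →
      (fv + gu) * ‖q.2‖ ≤ c * (F - g) := by
    intro c hc
    have h1 := mul_le_mul_of_nonneg_left hc hχ
    have h2 : f v * deriv χ v * ‖q.2‖ ≤ 0 :=
      mul_nonpos_of_nonpos_of_nonneg (mul_nonpos_of_nonneg_of_nonpos (hw.f_nonneg v hv0) hχ') hr.le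
    rw [hFg, hfv, hgu]
    rw [hvu] at h1
    linarith
  exact bulk_nonpos hr hsq (by positivity)
    (mul_nonpos_of_nonneg_of_nonpos (hw.k_nonneg u) hχ')
    (key 2 (hw.deriv_le_two u v huv huv')) (key (p - 1) (hw.deriv_le u v huv huv'))

/-! ### The integrated divergence inequality -/

section Divergence

variable {e : ℝ × E3 → ℝ} {T ρ : ℝ}

theorem fderiv_eq_zero_of_norm_gt (h0 : ∀ t ∈ Set.Ioo (-1) (T + 1), ∀ x : E3, ρ ≤ ‖x‖ → e (t, x) = 0)
    {t : ℝ} (ht : t ∈ Set.Icc 0 T) {x : E3} (hx : ρ < ‖x‖) : fderiv ℝ e (t, x) = 0 := by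
  have h : e =ᶠ[nhds (t, x)] fun _ => 0 := by
    have h1 : ∀ᶠ q : ℝ × E3 in nhds (t, x), q.1 ∈ Set.Ioo (-1) (T + 1) :=
      continuous_fst.continuousAt.eventually (Ioo_mem_nhds (by linarith [ht.1]) (by linarith [ht.2]))
    have h2 : ∀ᶠ q : ℝ × E3 in nhds (t, x), ρ < ‖q.2‖ :=
      (continuous_snd.norm.continuousAt (x := ((t, x) : ℝ × E3))).eventually (lt_mem_nhds hx)
    filter_upwards [h1, h2] with q hq1 hq2
    exact h0 q.1 hq1 q.2 hq2.le
  rw [h.fderiv_eq]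
  simp

theorem continuous_pd (he : ContDiff ℝ 1 e) (w : ℝ × E3) : Continuous (pd w e) :=
  (he.continuous_fderiv (by simp)).clm_apply continuous_const

theorem continuous_slice (he : Continuous e) (t : ℝ) : Continuous fun x : E3 => e (t, x) :=
  he.comp (Continuous.prodMk_right t)

theorem hasCompactSupport_of_norm_gt {g : E3 → ℝ} (h : ∀ x, ρ < ‖x‖ → g x = 0) :
    HasCompactSupport g :=
  HasCompactSupport.intro (isCompact_closedBall (0 : E3) ρ) fun x hx => h x (by simpa using hx)

theorem integral_fderiv_eq_zero {g : E3 → ℝ} (hg : ContDiff ℝ 1 g) (hs : HasCompactSupport g)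
    (v : E3) : ∫ x, fderiv ℝ g x v = 0 := by
  have h := integral_mul_fderiv_eq_neg_fderiv_mul_of_integrable (μ := (volume : Measure E3))
    (f := fun _ => (1 : ℝ)) (g := g) (v := v) (by simp) ?_ ?_ (by fun_prop)
    (fun x _ => hg.differentiable (by simp) x)
  · simpa using h
  · simp only [one_mul]
    exact ((hg.continuous_fderiv (by simp)).clm_apply continuous_const).integrable_of_hasCompactSupport
      (hs.fderiv_apply (𝕜 := ℝ) v)
  · simp only [one_mul]
    exact hg.continuous.integrable_of_hasCompactSupport hs

theorem integral_le_of_divergence_le {J : Fin 3 → ℝ × E3 → ℝ} {B : E3 → ℝ}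
    (hT : 0 ≤ T) (he : ContDiff ℝ 1 e) (hJ : ∀ i, ContDiff ℝ 1 (J i))
    (he0 : ∀ t ∈ Set.Ioo (-1) (T + 1), ∀ x : E3, ρ ≤ ‖x‖ → e (t, x) = 0)
    (hJ0 : ∀ i, ∀ t ∈ Set.Ioo (-1) (T + 1), ∀ x : E3, ρ ≤ ‖x‖ → J i (t, x) = 0)
    (hB : Integrable B)
    (hdiv : ∀ t ∈ Set.Icc 0 T, ∀ x, pd dirT e (t, x) + ∑ i, pd (dirX i) (J i) (t, x) ≤ B x) :
    ∫ x, e (T, x) ≤ (∫ x, e (0, x)) + T * ∫ x, B x := by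
  have hIoo : ∀ {t}, t ∈ Set.Icc 0 T → t ∈ Set.Ioo (-1) (T + 1) := fun h =>
    ⟨by linarith [h.1], by linarith [h.2]⟩
  have hes : ∀ t ∈ Set.Icc 0 T, HasCompactSupport fun x => pd dirT e (t, x) := fun t ht =>
    hasCompactSupport_of_norm_gt (ρ := ρ) fun x hx => by
      simp [pd, fderiv_eq_zero_of_norm_gt he0 ht hx]
  have hei : ∀ t ∈ Set.Icc 0 T, Integrable fun x => pd dirT e (t, x) := fun t ht =>
    ((continuous_pd he _).comp (by fun_prop)).integrable_of_hasCompactSupport (hes t ht)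
  have hJi : ∀ i, ∀ t ∈ Set.Icc 0 T, Integrable fun x => pd (dirX i) (J i) (t, x) := fun i t ht =>
    ((continuous_pd (hJ i) _).comp (by fun_prop)).integrable_of_hasCompactSupport
      (hasCompactSupport_of_norm_gt (ρ := ρ) fun x hx => by
        simp [pd, fderiv_eq_zero_of_norm_gt (hJ0 i) ht hx])
  have hJz : ∀ i, ∀ t ∈ Set.Icc 0 T, ∫ x, pd (dirX i) (J i) (t, x) = 0 := by
    intro i t ht
    have h1 : ContDiff ℝ 1 fun x => J i (t, x) := (hJ i).comp (by fun_prop)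
    have h2 := integral_fderiv_eq_zero h1
      (hasCompactSupport_of_norm_gt (ρ := ρ) fun x hx => hJ0 i t (hIoo ht) x hx.le)
      (EuclideanSpace.single i 1)
    rw [← h2]
    exact integral_congr_ae (Filter.Eventually.of_forall fun x =>
      (fderiv_slice (((hJ i).differentiable (by simp)) _) _).symm)
  have hslice : ∀ t ∈ Set.Icc 0 T, ∫ x, pd dirT e (t, x) ≤ ∫ x, B x := by
    intro t ht
    have h1 : ∫ x, (pd dirT e (t, x) + ∑ i, pd (dirX i) (J i) (t, x)) = ∫ x, pd dirT e (t, x) := by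
      rw [integral_add (hei t ht) (integrable_finsetSum _ fun i _ => hJi i t ht),
        integral_finsetSum _ fun i _ => hJi i t ht]
      simp [hJz _ t ht]
    rw [← h1]
    exact integral_mono ((hei t ht).add (integrable_finsetSum _ fun i _ => hJi i t ht)) hB
      (hdiv t ht)
  have hint : Integrable (Function.uncurry fun (x : E3) t => pd dirT e (t, x))
      (volume.prod (volume.restrict (Set.Ioc 0 T))) := by
    have hc : Continuous (Function.uncurry fun (x : E3) t => pd dirT e (t, x)) :=
      (continuous_pd he dirT).comp (continuous_snd.prodMk continuous_fst)
    have h1 : IntegrableOn (Function.uncurry fun (x : E3) t => pd dirT e (t, x))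
        (Metric.closedBall 0 ρ ×ˢ Set.Icc 0 T) (volume.prod volume) :=
      hc.continuousOn.integrableOn_compact ((isCompact_closedBall _ _).prod isCompact_Icc)
    have h2 : IntegrableOn (Function.uncurry fun (x : E3) t => pd dirT e (t, x))
        (Set.univ ×ˢ Set.Icc 0 T) (volume.prod volume) := by
      refine h1.of_forall_sdiff_eq_zero (MeasurableSet.univ.prod measurableSet_Icc) ?_
      rintro ⟨x, t⟩ ⟨⟨-, ht⟩, hx⟩
      have hx' : ρ < ‖x‖ := by
        by_contra hc
        exact hx ⟨by simpa using hc, ht⟩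
      simp [Function.uncurry, pd, fderiv_eq_zero_of_norm_gt he0 ht hx']
    have h3 := h2.mono_set (Set.prod_mono (Set.Subset.refl Set.univ)
      (Set.Ioc_subset_Icc_self (a := (0 : ℝ)) (b := T)))
    rw [IntegrableOn, ← Measure.prod_restrict, Measure.restrict_univ] at h3
    exact h3
  have hftc : ∀ x, ∫ t in (0 : ℝ)..T, pd dirT e (t, x) = e (T, x) - e (0, x) := by
    intro x
    refine intervalIntegral.integral_eq_sub_of_hasDerivAt (f := fun t => e (t, x)) (fun t _ => ?_) ?_
    · have h : HasDerivAt (fun s : ℝ => ((s, x) : ℝ × E3)) dirT t :=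
        (hasDerivAt_id t).prodMk (hasDerivAt_const t x)
      exact ((he.differentiable (by simp)) (t, x)).hasFDerivAt.comp_hasDerivAt t h
    · exact ((continuous_pd he _).comp (by fun_prop)).intervalIntegrable _ _
  have hei' : ∀ t ∈ Set.Icc 0 T, Integrable fun x => e (t, x) := fun t ht =>
    (he.continuous.comp (by fun_prop)).integrable_of_hasCompactSupport
      (hasCompactSupport_of_norm_gt (ρ := ρ) fun x hx => he0 t (hIoo ht) x hx.le)
  have hswap := integral_integral_swap hint
  simp only [← intervalIntegral.integral_of_le hT] at hswap
  simp only [hftc] at hswap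
  rw [integral_sub (hei' T ⟨hT, le_rfl⟩) (hei' 0 ⟨le_rfl, hT⟩)] at hswap
  have hle : ∫ t in (0 : ℝ)..T, ∫ x, pd dirT e (t, x) ≤ ∫ t in (0 : ℝ)..T, ∫ x, B x := by
    refine intervalIntegral.integral_mono_on hT ?_ (by simp) hslice
    rw [intervalIntegrable_iff_integrableOn_Ioc_of_le hT]
    exact hint.integral_prod_right
  rw [intervalIntegral.integral_const, smul_eq_mul, sub_zero] at hle
  linarith

end Divergence

/-! ### The cutoff near the origin -/

theorem deriv_smoothTransition_nonneg (s : ℝ) : 0 ≤ deriv Real.smoothTransition s :=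
  Real.smoothTransition.monotone.deriv_nonneg

theorem deriv_smoothTransition_eq_zero {s : ℝ} (hs : s < 0 ∨ 1 < s) :
    deriv Real.smoothTransition s = 0 := by
  rcases hs with hs | hs
  · have h : Real.smoothTransition =ᶠ[nhds s] fun _ => 0 := by
      filter_upwards [gt_mem_nhds hs] with y hy
      exact Real.smoothTransition.zero_of_nonpos hy.le
    rw [h.deriv_eq]; simp
  · have h : Real.smoothTransition =ᶠ[nhds s] fun _ => 1 := by
      filter_upwards [lt_mem_nhds hs] with y hy
      exact Real.smoothTransition.one_of_one_le hy.le
    rw [h.deriv_eq]; simp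

theorem contDiff_smoothTransition : ContDiff ℝ 1 Real.smoothTransition :=
  Real.smoothTransition.contDiff

theorem exists_deriv_smoothTransition_le : ∃ M, 0 ≤ M ∧ ∀ s, deriv Real.smoothTransition s ≤ M := by
  obtain ⟨M, hM⟩ := (isCompact_Icc (a := (0 : ℝ)) (b := 1)).exists_bound_of_continuousOn
    (contDiff_smoothTransition.continuous_deriv (by simp)).continuousOn
  have hM0 : 0 ≤ M := (norm_nonneg _).trans (hM 0 (by simp))
  refine ⟨M, hM0, fun s => ?_⟩
  by_cases hs : s ∈ Set.Icc (0 : ℝ) 1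
  · exact (le_abs_self _).trans (hM s hs)
  · rw [deriv_smoothTransition_eq_zero]
    · exact hM0
    · by_contra! h
      exact hs h

/-- A cutoff function that vanishes on the ball of radius `δ` and is `1` off the ball of
radius `2δ`. -/
def cutO (δ : ℝ) (x : E3) : ℝ := Real.smoothTransition (‖x‖ / δ - 1)

section CutO

variable {δ : ℝ} {x : E3}

theorem cutO_nonneg : 0 ≤ cutO δ x := Real.smoothTransition.nonneg _

theorem cutO_le_one : cutO δ x ≤ 1 := Real.smoothTransition.le_one _

theorem cutO_eq_zero (hδ : 0 < δ) (hx : ‖x‖ ≤ δ) : cutO δ x = 0 :=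
  Real.smoothTransition.zero_of_nonpos (by rw [sub_nonpos, div_le_one hδ]; exact hx)

theorem cutO_eq_one (hδ : 0 < δ) (hx : 2 * δ ≤ ‖x‖) : cutO δ x = 1 :=
  Real.smoothTransition.one_of_one_le (by rw [le_sub_iff_add_le, le_div_iff₀ hδ]; linarith)

theorem contDiffAt_cutO (hx : x ≠ 0) : ContDiffAt ℝ 1 (cutO δ) x :=
  contDiff_smoothTransition.contDiffAt.comp x
    (((contDiffAt_id.norm ℝ hx).div_const δ).sub contDiffAt_const)

theorem cutO_mul_eventuallyEq_zero (hδ : 0 < δ) (e : ℝ × E3 → ℝ) {q : ℝ × E3} (hq : ‖q.2‖ < δ) :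
    (fun q : ℝ × E3 => cutO δ q.2 * e q) =ᶠ[nhds q] fun _ => 0 := by
  filter_upwards [(continuous_snd.norm.continuousAt (x := q)).eventually (gt_mem_nhds hq)] with y hy
  rw [cutO_eq_zero hδ hy.le, zero_mul]

theorem contDiff_cutO_mul (hδ : 0 < δ) {e : ℝ × E3 → ℝ}
    (he : ∀ q : ℝ × E3, q.2 ≠ 0 → ContDiffAt ℝ 1 e q) :
    ContDiff ℝ 1 fun q : ℝ × E3 => cutO δ q.2 * e q := by
  rw [contDiff_iff_contDiffAt]
  intro q
  by_cases hq : q.2 = 0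
  · exact contDiffAt_const.congr_of_eventuallyEq
      (cutO_mul_eventuallyEq_zero hδ e (by rw [hq]; simpa using hδ))
  · exact ((contDiffAt_cutO hq).comp q contDiffAt_snd).mul (he q hq)

theorem pd_dirT_cutO_mul {e : ℝ × E3 → ℝ} {q : ℝ × E3} (hq : q.2 ≠ 0)
    (he : DifferentiableAt ℝ e q) :
    pd dirT (fun q : ℝ × E3 => cutO δ q.2 * e q) q = cutO δ q.2 * pd dirT e q := by
  have h1 : DifferentiableAt ℝ (fun q : ℝ × E3 => cutO δ q.2) q :=
    (((contDiffAt_cutO hq).comp q contDiffAt_snd)).differentiableAt (by simp)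
  have h2 := hasDerivAt_line (h1.mul he) dirT
  have h3 : HasDerivAt (fun s : ℝ => cutO δ q.2 * e (q + s • dirT)) (cutO δ q.2 * pd dirT e q) 0 :=
    (hasDerivAt_line he dirT).const_mul _
  refine h2.unique (h3.congr_of_eventuallyEq (Filter.Eventually.of_forall fun s => ?_))
  simp [dirT]

theorem pd_dirX_cutO_mul {e : ℝ × E3 → ℝ} {q : ℝ × E3} (hq : q.2 ≠ 0)
    (he : DifferentiableAt ℝ e q) (i : Fin 3) :
    pd (dirX i) (fun q : ℝ × E3 => cutO δ q.2 * e q) q = cutO δ q.2 * pd (dirX i) e q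
      + deriv Real.smoothTransition (‖q.2‖ / δ - 1) / δ / ‖q.2‖ * (e q * q.2 i) := by
  have h1 : DifferentiableAt ℝ (fun q : ℝ × E3 => cutO δ q.2) q :=
    (((contDiffAt_cutO hq).comp q contDiffAt_snd)).differentiableAt (by simp)
  have h2 := hasDerivAt_line (h1.mul he) (dirX i)
  have h3 : HasDerivAt (fun s : ℝ => cutO δ (q + s • dirX i).2)
      (deriv Real.smoothTransition (‖q.2‖ / δ - 1) * (q.2 i / ‖q.2‖ / δ)) 0 := by
    have h4 := ((hasDerivAt_norm_line hq i).div_const δ).sub_const 1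
    have h5 := ((contDiff_smoothTransition.differentiable (by simp))
      (‖q.2 + (0 : ℝ) • (EuclideanSpace.single i 1 : E3)‖ / δ - 1)).hasDerivAt.comp (0 : ℝ) h4
    simp only [zero_smul, add_zero] at h5
    exact h5
  refine h2.unique ((h3.mul (hasDerivAt_line he (dirX i))).congr_deriv ?_)
  simp only [zero_smul, add_zero]
  ring

end CutO

/-! ### The weighted energy inequality -/

section Energy

variable {p : ℝ} {f k χ : ℝ → ℝ} {Φ : ℝ × E3 → ℝ}

theorem AdmissibleWeights.inW_le_outW (hw : AdmissibleWeights p f k χ) {t r : ℝ} (ht : 0 ≤ t)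
    (hr : 0 ≤ r) : inW k χ t r ≤ outW f χ t r :=
  mul_le_mul_of_nonneg_right (hw.k_le_f _ _ (by linarith) (by linarith)) (hw.χ_nonneg _)

theorem AdmissibleWeights.outW_nonneg (hw : AdmissibleWeights p f k χ) {t r : ℝ} (ht : 0 ≤ t)
    (hr : 0 ≤ r) : 0 ≤ outW f χ t r :=
  mul_nonneg (hw.f_nonneg _ (by linarith)) (hw.χ_nonneg _)

theorem AdmissibleWeights.inW_nonneg (hw : AdmissibleWeights p f k χ) (t r : ℝ) :
    0 ≤ inW k χ t r :=
  mul_nonneg (hw.k_nonneg _) (hw.χ_nonneg _)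

theorem le_enD (hw : AdmissibleWeights p f k χ) (hp : 2 < p) {q : ℝ × E3} (hq : q.2 ≠ 0)
    (ht : 0 ≤ q.1) :
    outW f χ q.1 ‖q.2‖ * (|Φ q| ^ (p + 1) / (p + 1)) ≤ enD p f k χ Φ q := by
  have hV : 0 ≤ |Φ q| ^ (p + 1) / (p + 1) := by positivity
  refine le_trans ?_ (le_dens (norm_pos_iff.2 hq) (E3.sum_sq q.2)
    (hw.outW_nonneg ht (norm_nonneg _)) (hw.inW_nonneg _ _))
  exact mul_le_mul_of_nonneg_right (le_add_of_nonneg_right (hw.inW_nonneg _ _)) hV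

theorem enD_nonneg (hw : AdmissibleWeights p f k χ) (hp : 2 < p) {q : ℝ × E3} (hq : q.2 ≠ 0)
    (ht : 0 ≤ q.1) : 0 ≤ enD p f k χ Φ q :=
  le_trans (mul_nonneg (hw.outW_nonneg ht (norm_nonneg _)) (by positivity)) (le_enD hw hp hq ht)

/-- Quantity controlling the energy density at the initial time. -/
def initD (p : ℝ) (Φ : ℝ × E3 → ℝ) (x : E3) : ℝ :=
  pd dirT Φ (0, x) ^ 2 + ∑ j, pd (dirX j) Φ (0, x) ^ 2 + Φ (0, x) ^ 2 / ‖x‖ ^ 2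
    + |Φ (0, x)| ^ (p + 1) / (p + 1)

theorem initD_nonneg (hp : 2 < p) (x : E3) : 0 ≤ initD p Φ x := by
  unfold initD
  positivity

theorem enD_zero_le (hw : AdmissibleWeights p f k χ) (hp : 2 < p) (hχ : ∀ v, χ v ≤ 1)
    (hfk : ∀ v, 0 ≤ v → f v = k (-v)) {x : E3} (hx : x ≠ 0) :
    enD p f k χ Φ (0, x) ≤ 2 * f (‖x‖ / 2) * initD p Φ x := by
  have hr : 0 < ‖x‖ := norm_pos_iff.2 hx
  have h1 : inW k χ 0 ‖x‖ = outW f χ 0 ‖x‖ := by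
    have : (0 - ‖x‖) / 2 = -((0 + ‖x‖) / 2) := by ring
    rw [inW, outW, this, ← hfk _ (by positivity)]
  have h2 : outW f χ 0 ‖x‖ ≤ f (‖x‖ / 2) := by
    rw [outW, zero_add]
    exact mul_le_of_le_one_right (hw.f_nonneg _ (by positivity)) (hχ _)
  have h3 := hw.outW_nonneg le_rfl hr.le
  unfold enD
  simp only [h1, sub_self, zero_div]
  refine (dens_zero_le hr (E3.sum_sq x) (add_nonneg h3 h3)).trans ?_
  exact mul_le_mul_of_nonneg_right (by linarith) (initD_nonneg hp x)

theorem exists_sum_enJ_mul_le (hw : AdmissibleWeights p f k χ) (hp : 2 < p)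
    (hΦ : ContDiff ℝ (⊤ : ℕ∞) Φ) (T : ℝ) :
    ∃ K, 0 ≤ K ∧ ∀ t ∈ Set.Icc 0 T, ∀ x : E3, x ≠ 0 → ‖x‖ ≤ 2 →
      ∑ i, enJ p f k χ Φ i (t, x) * x i ≤ K := by
  have hf := hw.contDiff_f.continuous
  have hk := hw.contDiff_k.continuous
  have hχ := hw.contDiff_χ.continuous
  have hF : Continuous fun q : ℝ × E3 => outW f χ q.1 ‖q.2‖ := by unfold outW; fun_prop
  have hg : Continuous fun q : ℝ × E3 => inW k χ q.1 ‖q.2‖ := by unfold inW; fun_prop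
  have hpd : ∀ w, Continuous (pd w Φ) := fun w => (contDiff_pd hΦ w).continuous
  have hV := (contDiff_potential hp hΦ).continuous
  have hx : ∀ j, Continuous fun q : ℝ × E3 => q.2 j := fun j => (contDiff_coord j).continuous
  have hΦc := hΦ.continuous
  have hc : Continuous fun q : ℝ × E3 =>
      |outW f χ q.1 ‖q.2‖ + inW k χ q.1 ‖q.2‖| * |pd dirT Φ q|
          * (|∑ j, q.2 j * pd (dirX j) Φ q| + |Φ q|)
        + ‖q.2‖ * (outW f χ q.1 ‖q.2‖ - inW k χ q.1 ‖q.2‖)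
          * ((∑ j, pd (dirX j) Φ q ^ 2) / 2 + |(|Φ q| ^ (p + 1) / (p + 1))|) := by
    have h1 : Continuous fun q : ℝ × E3 => ∑ j, q.2 j * pd (dirX j) Φ q :=
      continuous_finsetSum _ fun j _ => (hx j).mul (hpd _)
    have h2 : Continuous fun q : ℝ × E3 => ∑ j, pd (dirX j) Φ q ^ 2 :=
      continuous_finsetSum _ fun j _ => (hpd _).pow 2
    exact (((hF.add hg).abs.mul (hpd _).abs).mul (h1.abs.add hΦc.abs)).add
      ((continuous_snd.norm.mul (hF.sub hg)).mul ((h2.div_const 2).add hV.abs))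
  obtain ⟨K, hK⟩ := ((isCompact_Icc (a := (0 : ℝ)) (b := T)).prod
    (isCompact_closedBall (0 : E3) 2)).exists_bound_of_continuousOn hc.continuousOn
  refine ⟨max K 0, le_max_right _ _, fun t ht x hx0 hx2 => ?_⟩
  have h1 := hK (t, x) ⟨ht, by simpa using hx2⟩
  have h2 := sum_flux_mul_le (φ := Φ (t, x)) (a := pd dirT Φ (t, x))
    (V := |Φ (t, x)| ^ (p + 1) / (p + 1)) (P := fun j => pd (dirX j) Φ (t, x))
    (norm_pos_iff.2 hx0) (E3.sum_sq x) (hw.inW_le_outW ht.1 (norm_nonneg x))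
  exact h2.trans ((le_abs_self _).trans (h1.trans (le_max_left _ _)))

theorem pd_cutO_mul_le (hw : AdmissibleWeights p f k χ) (hp : 2 < p)
    (hΦ : ContDiff ℝ (⊤ : ℕ∞) Φ) {T M K δ : ℝ} (hδ : 0 < δ) (hδ1 : δ ≤ 1) (hM : 0 ≤ M)
    (hMb : ∀ s, deriv Real.smoothTransition s ≤ M) (hK : 0 ≤ K)
    (hKb : ∀ t ∈ Set.Icc 0 T, ∀ x : E3, x ≠ 0 → ‖x‖ ≤ 2 → ∑ i, enJ p f k χ Φ i (t, x) * x i ≤ K)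
    (heq : ∀ q : ℝ × E3, 0 ≤ q.1 → pd dirT (pd dirT Φ) q
      - ∑ i, pd (dirX i) (pd (dirX i) Φ) q + |Φ q| ^ (p - 1) * Φ q = 0)
    {t : ℝ} (ht : t ∈ Set.Icc 0 T) (x : E3) :
    pd dirT (fun q => cutO δ q.2 * enD p f k χ Φ q) (t, x)
      + ∑ i, pd (dirX i) (fun q => cutO δ q.2 * enJ p f k χ Φ i q) (t, x)
      ≤ (Metric.closedBall (0 : E3) (2 * δ)).indicator (fun _ => M * K / δ ^ 2) x := by
  have hMK : 0 ≤ M * K / δ ^ 2 := by positivity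
  have hind : 0 ≤ (Metric.closedBall (0 : E3) (2 * δ)).indicator (fun _ => M * K / δ ^ 2) x :=
    Set.indicator_nonneg (fun _ _ => hMK) x
  rcases lt_or_ge ‖x‖ δ with hxδ | hxδ
  · have h0 : ∀ (e : ℝ × E3 → ℝ) w, pd w (fun q => cutO δ q.2 * e q) (t, x) = 0 := fun e w => by
      rw [pd, (cutO_mul_eventuallyEq_zero (q := (t, x)) hδ e hxδ).fderiv_eq]
      simp
    simpa [h0] using hind
  have hr : 0 < ‖x‖ := hδ.trans_le hxδ
  have hx0 : x ≠ 0 := norm_pos_iff.1 hr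
  rw [pd_dirT_cutO_mul hx0 ((contDiffAt_enD hw hp hΦ hx0).differentiableAt (by simp)),
    Finset.sum_congr rfl fun i _ => pd_dirX_cutO_mul (q := (t, x)) hx0
      ((contDiffAt_enJ hw hp hΦ i hx0).differentiableAt (by simp)) i,
    Finset.sum_add_distrib, ← Finset.mul_sum, ← Finset.mul_sum, ← add_assoc, ← mul_add]
  have h1 := mul_nonpos_of_nonneg_of_nonpos (cutO_nonneg (δ := δ) (x := x))
    (pd_enD_add_sum_pd_enJ_nonpos hw hp hΦ (q := (t, x)) hx0 ht.1 (heq _ ht.1))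
  refine (add_le_add_left h1 _).trans ?_
  rw [zero_add]
  rcases lt_or_ge (2 * δ) ‖x‖ with hx2 | hx2
  · rw [deriv_smoothTransition_eq_zero (Or.inr (by rw [lt_sub_iff_add_lt, lt_div_iff₀ hδ]; linarith))]
    simpa using hind
  · rw [Set.indicator_of_mem (by simpa using hx2)]
    have h2 := hKb t ht x hx0 (by linarith)
    have h3 := deriv_smoothTransition_nonneg (‖x‖ / δ - 1)
    calc deriv Real.smoothTransition (‖x‖ / δ - 1) / δ / ‖x‖ * ∑ i, enJ p f k χ Φ i (t, x) * x i
        ≤ deriv Real.smoothTransition (‖x‖ / δ - 1) / δ / ‖x‖ * K :=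
          mul_le_mul_of_nonneg_left h2 (by positivity)
      _ ≤ M / δ / δ * K := by
          gcongr
          exact hMb _
      _ = M * K / δ ^ 2 := by ring

theorem exists_integral_cutO_mul_enD_le (hw : AdmissibleWeights p f k χ) (hp : 2 < p)
    (hΦ : ContDiff ℝ (⊤ : ℕ∞) Φ) {T L : ℝ} (hT : 0 ≤ T) (hL : ∀ v, L ≤ v → χ v = 0)
    (heq : ∀ q : ℝ × E3, 0 ≤ q.1 → pd dirT (pd dirT Φ) q
      - ∑ i, pd (dirX i) (pd (dirX i) Φ) q + |Φ q| ^ (p - 1) * Φ q = 0) :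
    ∃ C, ∀ δ, 0 < δ → δ ≤ 1 →
      Continuous (fun q : ℝ × E3 => cutO δ q.2 * enD p f k χ Φ q) ∧
      (∀ t ∈ Set.Icc 0 T, Integrable fun x => cutO δ x * enD p f k χ Φ (t, x)) ∧
      ∫ x, cutO δ x * enD p f k χ Φ (T, x)
        ≤ (∫ x, cutO δ x * enD p f k χ Φ (0, x)) + C * δ := by
  obtain ⟨M, hM, hMb⟩ := exists_deriv_smoothTransition_le
  obtain ⟨K, hK, hKb⟩ := exists_sum_enJ_mul_le hw hp hΦ T
  refine ⟨T * (M * K * 8 * (volume : Measure E3).real (Metric.closedBall 0 1)),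
    fun δ hδ hδ1 => ?_⟩
  have hv : ∀ t ∈ Set.Ioo (-1) (T + 1), ∀ x : E3, 2 * L + 1 ≤ ‖x‖ → χ ((t + ‖x‖) / 2) = 0 :=
    fun t ht x hx => hL _ (by linarith [ht.1])
  have he : ContDiff ℝ 1 fun q : ℝ × E3 => cutO δ q.2 * enD p f k χ Φ q :=
    contDiff_cutO_mul hδ fun q hq => contDiffAt_enD hw hp hΦ hq
  have hJ : ∀ i, ContDiff ℝ 1 fun q : ℝ × E3 => cutO δ q.2 * enJ p f k χ Φ i q := fun i =>
    contDiff_cutO_mul hδ fun q hq => contDiffAt_enJ hw hp hΦ i hq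
  have he0 : ∀ t ∈ Set.Ioo (-1) (T + 1), ∀ x : E3, 2 * L + 1 ≤ ‖x‖ →
      cutO δ x * enD p f k χ Φ (t, x) = 0 := fun t ht x hx => by
    simp [enD, outW, inW, hv t ht x hx, dens]
  have hJ0 : ∀ i, ∀ t ∈ Set.Ioo (-1) (T + 1), ∀ x : E3, 2 * L + 1 ≤ ‖x‖ →
      cutO δ x * enJ p f k χ Φ i (t, x) = 0 := fun i t ht x hx => by
    simp [enJ, outW, inW, hv t ht x hx, flux]
  have hBm : MeasurableSet (Metric.closedBall (0 : E3) (2 * δ)) := measurableSet_closedBall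
  have hmain := integral_le_of_divergence_le (ρ := 2 * L + 1)
    (e := fun q : ℝ × E3 => cutO δ q.2 * enD p f k χ Φ q)
    (J := fun i q => cutO δ q.2 * enJ p f k χ Φ i q)
    (B := (Metric.closedBall (0 : E3) (2 * δ)).indicator fun _ => M * K / δ ^ 2) hT he
    hJ he0 hJ0
    ((integrable_indicator_iff hBm).2 (integrableOn_const measure_closedBall_lt_top.ne))
    (fun t ht x => pd_cutO_mul_le hw hp hΦ hδ hδ1 hM hMb hK hKb heq ht x)
  refine ⟨he.continuous, fun t ht => ?_, hmain.trans_eq ?_⟩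
  · have hc : Continuous fun x : E3 => cutO δ x * enD p f k χ Φ (t, x) :=
      continuous_slice he.continuous t
    exact hc.integrable_of_hasCompactSupport
      (hasCompactSupport_of_norm_gt (ρ := 2 * L + 1) fun x hx =>
        he0 t ⟨by linarith [ht.1], by linarith [ht.2]⟩ x hx.le)
  · congr 1
    rw [integral_indicator hBm, setIntegral_const, Measure.addHaar_real_closedBall' _ _ (by positivity)]
    simp only [finrank_euclideanSpace, Fintype.card_fin, smul_eq_mul]
    field_simp
    ring

end Energy

theorem continuous_cutO (δ : ℝ) : Continuous (cutO δ) := by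
  unfold cutO
  exact Real.smoothTransition.continuous.comp (by fun_prop)

theorem lintegral_outW_mul_le {p : ℝ} {f k χ : ℝ → ℝ} {φ : ℝ → E3 → ℝ}
    (hw : AdmissibleWeights p f k χ) (hp : 2 < p) (hφ : IsNLWSolution p φ) {T L : ℝ} (hT : 0 ≤ T)
    (hL : ∀ v, L ≤ v → χ v = 0) (hχ : ∀ v, χ v ≤ 1) (hfk : ∀ v, 0 ≤ v → f v = k (-v)) :
    ∫⁻ x : E3, ENNReal.ofReal (outW f χ T ‖x‖ * (|φ T x| ^ (p + 1) / (p + 1)))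
      ≤ ∫⁻ x : E3, ENNReal.ofReal (2 * f (‖x‖ / 2) * initD p (fun q => φ q.1 q.2) x) := by
  set Φ : ℝ × E3 → ℝ := fun q => φ q.1 q.2 with hΦ
  obtain ⟨C, hC⟩ := exists_integral_cutO_mul_enD_le hw hp hφ.1 hT hL fun q hq => hφ.eq_zero hq
  set D := ∫⁻ x : E3, ENNReal.ofReal (2 * f (‖x‖ / 2) * initD p Φ x) with hD
  have hnn : ∀ δ, 0 < δ → ∀ t, 0 ≤ t → ∀ x, 0 ≤ cutO δ x * enD p f k χ Φ (t, x) := by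
    intro δ hδ t ht x
    rcases eq_or_ne x 0 with rfl | hx
    · rw [cutO_eq_zero hδ (by simpa using hδ.le), zero_mul]
    · exact mul_nonneg cutO_nonneg (enD_nonneg hw hp hx ht)
  have h1 : ∀ δ, 0 < δ → δ ≤ 1 →
      ∫⁻ x, ENNReal.ofReal (cutO δ x * (outW f χ T ‖x‖ * (|φ T x| ^ (p + 1) / (p + 1))))
        ≤ D + ENNReal.ofReal (C * δ) := by
    intro δ hδ hδ1
    obtain ⟨-, hi, hle⟩ := hC δ hδ hδ1
    have e0 : ENNReal.ofReal (∫ x, cutO δ x * enD p f k χ Φ (0, x)) ≤ D := by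
      rw [ofReal_integral_eq_lintegral_ofReal (hi 0 ⟨le_rfl, hT⟩)
        (Filter.Eventually.of_forall (hnn δ hδ 0 le_rfl))]
      refine lintegral_mono fun x => ENNReal.ofReal_le_ofReal ?_
      rcases eq_or_ne x 0 with rfl | hx
      · rw [cutO_eq_zero hδ (by simpa using hδ.le), zero_mul]
        exact mul_nonneg (mul_nonneg zero_le_two (hw.f_nonneg _ (by simp))) (initD_nonneg hp _)
      · exact (mul_le_of_le_one_left (enD_nonneg hw hp hx le_rfl) cutO_le_one).trans
          (enD_zero_le hw hp hχ hfk hx)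
    calc ∫⁻ x, ENNReal.ofReal (cutO δ x * (outW f χ T ‖x‖ * (|φ T x| ^ (p + 1) / (p + 1))))
        ≤ ∫⁻ x, ENNReal.ofReal (cutO δ x * enD p f k χ Φ (T, x)) := by
          refine lintegral_mono fun x => ENNReal.ofReal_le_ofReal ?_
          rcases eq_or_ne x 0 with rfl | hx
          · rw [cutO_eq_zero hδ (by simpa using hδ.le), zero_mul, zero_mul]
          · exact mul_le_mul_of_nonneg_left (le_enD (Φ := Φ) hw hp (q := (T, x)) hx hT) cutO_nonneg
      _ = ENNReal.ofReal (∫ x, cutO δ x * enD p f k χ Φ (T, x)) :=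
          (ofReal_integral_eq_lintegral_ofReal (hi T ⟨hT, le_rfl⟩)
            (Filter.Eventually.of_forall (hnn δ hδ T hT))).symm
      _ ≤ ENNReal.ofReal ((∫ x, cutO δ x * enD p f k χ Φ (0, x)) + C * δ) :=
          ENNReal.ofReal_le_ofReal hle
      _ ≤ D + ENNReal.ofReal (C * δ) := ENNReal.ofReal_add_le.trans (by gcongr)
  have hcont : Continuous fun x : E3 => outW f χ T ‖x‖ * (|φ T x| ^ (p + 1) / (p + 1)) := by
    have hf := hw.contDiff_f.continuous
    have hc := hw.contDiff_χ.continuous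
    have hV := continuous_slice (contDiff_potential hp hφ.1).continuous T
    unfold outW
    exact Continuous.mul (by fun_prop) hV
  let δ : ℕ → ℝ := fun n => 1 / ((n : ℝ) + 1)
  have hδ : ∀ n, 0 < δ n := fun n => by positivity
  have hδ1 : ∀ n, δ n ≤ 1 := fun n => by
    rw [div_le_one (by positivity)]
    linarith [(Nat.cast_nonneg n : (0 : ℝ) ≤ n)]
  have hδ0 : Filter.Tendsto δ Filter.atTop (nhds 0) := tendsto_one_div_add_atTop_nhds_zero_nat
  have hne : ∀ᵐ x : E3, x ≠ 0 := compl_mem_ae_iff.2 (measure_singleton 0)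
  calc ∫⁻ x : E3, ENNReal.ofReal (outW f χ T ‖x‖ * (|φ T x| ^ (p + 1) / (p + 1)))
      = ∫⁻ x, Filter.liminf (fun n => ENNReal.ofReal
          (cutO (δ n) x * (outW f χ T ‖x‖ * (|φ T x| ^ (p + 1) / (p + 1))))) Filter.atTop := by
        refine lintegral_congr_ae ?_
        filter_upwards [hne] with x hx
        refine (Filter.Tendsto.liminf_eq (tendsto_const_nhds.congr' ?_)).symm
        filter_upwards [hδ0.eventually (gt_mem_nhds (half_pos (norm_pos_iff.2 hx)))] with n hn
        rw [cutO_eq_one (hδ n) (by linarith), one_mul]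
    _ ≤ Filter.liminf (fun n => ∫⁻ x, ENNReal.ofReal
          (cutO (δ n) x * (outW f χ T ‖x‖ * (|φ T x| ^ (p + 1) / (p + 1))))) Filter.atTop :=
        lintegral_liminf_le fun n =>
          (((continuous_cutO (δ n)).mul hcont).measurable).ennreal_ofReal
    _ ≤ Filter.liminf (fun n => D + ENNReal.ofReal (C * δ n)) Filter.atTop :=
        Filter.liminf_le_liminf (Filter.Eventually.of_forall fun n => h1 _ (hδ n) (hδ1 n))
    _ = D := by
        refine Filter.Tendsto.liminf_eq ?_
        have h2 := (ENNReal.tendsto_ofReal (hδ0.const_mul C)).const_add D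
        simpa using h2

/-! ### Power weights -/

theorem hasDerivAt_max_rpow {γ : ℝ} (hγ : 1 < γ) (v : ℝ) :
    HasDerivAt (fun v : ℝ => (max v 0) ^ γ) (γ * (max v 0) ^ (γ - 1)) v := by
  have hc : ∀ {c : ℝ}, 0 < c → Continuous fun v : ℝ => (max v 0) ^ c := fun hc =>
    (continuous_id.max continuous_const).rpow_const fun _ => Or.inr hc.le
  refine hasDerivAt_of_hasDerivAt_of_ne' (x := 0) (f := fun v : ℝ => (max v 0) ^ γ)
    (g := fun v : ℝ => γ * (max v 0) ^ (γ - 1)) (fun y hy => ?_)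
    (hc (by linarith)).continuousAt ((hc (by linarith)).const_mul γ).continuousAt v
  rcases lt_or_gt_of_ne hy with hy | hy
  · have h : (fun v : ℝ => (max v 0) ^ γ) =ᶠ[nhds y] fun _ => 0 := by
      filter_upwards [gt_mem_nhds hy] with w hw
      rw [max_eq_right hw.le, Real.zero_rpow (by linarith)]
    rw [max_eq_right hy.le, Real.zero_rpow (by linarith), mul_zero]
    exact (hasDerivAt_const y 0).congr_of_eventuallyEq h
  · have h : (fun v : ℝ => (max v 0) ^ γ) =ᶠ[nhds y] fun v => v ^ γ := by
      filter_upwards [lt_mem_nhds hy] with w hw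
      rw [max_eq_left hw.le]
    rw [max_eq_left hy.le]
    exact (Real.hasDerivAt_rpow_const (Or.inl hy.ne')).congr_of_eventuallyEq h

theorem contDiff_max_rpow {γ : ℝ} (hγ : 1 < γ) : ContDiff ℝ 1 fun v : ℝ => (max v 0) ^ γ := by
  rw [contDiff_one_iff_deriv]
  refine ⟨fun v => (hasDerivAt_max_rpow hγ v).differentiableAt, ?_⟩
  rw [funext fun v => (hasDerivAt_max_rpow hγ v).deriv]
  exact ((continuous_id.max continuous_const).rpow_const fun _ => Or.inr (by simp; linarith)).const_mul γ

/-- The truncated power weight `1 + v₊ ^ γ`. -/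
def powW (γ v : ℝ) : ℝ := 1 + (max v 0) ^ γ

theorem powW_of_nonneg {γ v : ℝ} (hv : 0 ≤ v) : powW γ v = 1 + v ^ γ := by
  rw [powW, max_eq_left hv]

theorem sub_rpow_mul_add_le {γ a v : ℝ} (hγ : 1 < γ) (hγ2 : γ < 2) (ha : 0 ≤ a) (hav : a ≤ v) :
    (v ^ (γ - 1) - a ^ (γ - 1)) * (v + a) ≤ v ^ γ - a ^ γ := by
  rcases ha.eq_or_lt with rfl | ha
  · rcases hav.eq_or_lt with rfl | hv
    · simp
    · rw [Real.zero_rpow (by linarith), Real.zero_rpow (by linarith), sub_zero, add_zero,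
        Real.rpow_sub_one hv.ne', div_mul_cancel₀ _ hv.ne', sub_zero]
  · have hv : 0 < v := ha.trans_le hav
    have e1 : ∀ {b : ℝ}, 0 < b → b ^ γ = b ^ (γ - 1) * b := fun hb => by
      rw [Real.rpow_sub_one hb.ne', div_mul_cancel₀ _ hb.ne']
    have e2 : ∀ {b : ℝ}, 0 < b → b = b ^ (γ - 1) * b ^ (2 - γ) := fun hb => by
      rw [← Real.rpow_add hb, show γ - 1 + (2 - γ) = 1 by ring, Real.rpow_one]
    have h : a * v ^ (γ - 1) ≤ v * a ^ (γ - 1) :=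
      calc a * v ^ (γ - 1) = a ^ (γ - 1) * v ^ (γ - 1) * a ^ (2 - γ) := by
            nth_rewrite 1 [e2 ha]; ring
        _ ≤ a ^ (γ - 1) * v ^ (γ - 1) * v ^ (2 - γ) := by
            have := Real.rpow_le_rpow ha.le hav (by linarith : 0 ≤ 2 - γ)
            gcongr
        _ = v * a ^ (γ - 1) := by nth_rewrite 3 [e2 hv]; ring
    rw [e1 ha, e1 hv]
    linarith

theorem admissibleWeights_powW {p γ R : ℝ} (hγ : 1 < γ) (hγ2 : γ < 2) (hγp : γ ≤ p - 1) :
    AdmissibleWeights p (powW γ) (fun u => powW γ (-u))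
      (fun v => Real.smoothTransition (R + 1 - v)) := by
  have hfd : ∀ v, HasDerivAt (powW γ) (γ * (max v 0) ^ (γ - 1)) v := fun v =>
    (hasDerivAt_max_rpow hγ v).const_add 1
  have hkd : ∀ u, HasDerivAt (fun u => powW γ (-u)) (-(γ * (max (-u) 0) ^ (γ - 1))) u := fun u =>
    ((hfd (-u)).comp u (hasDerivAt_neg u)).congr_deriv (by ring)
  have hf : ContDiff ℝ 1 (powW γ) := contDiff_const.add (contDiff_max_rpow hγ)
  have hfnn : ∀ v, 0 ≤ powW γ v := fun v => by unfold powW; positivity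
  have hmono : ∀ u v : ℝ, 0 ≤ u + v → u ≤ v → max (-u) 0 ≤ max v 0 := fun u v h1 h2 =>
    max_le_max_right 0 (by linarith)
  have hle : ∀ u v : ℝ, 0 ≤ u + v → u ≤ v → powW γ (-u) ≤ powW γ v := fun u v h1 h2 => by
    have := Real.rpow_le_rpow (le_max_right _ _) (hmono u v h1 h2) (by linarith : 0 ≤ γ)
    unfold powW
    linarith
  have hkey : ∀ c, γ ≤ c → ∀ u v : ℝ, 0 ≤ u + v → u ≤ v →
      (deriv (powW γ) v + deriv (fun u => powW γ (-u)) u) * (v - u)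
        ≤ c * (powW γ v - powW γ (-u)) := by
    intro c hc u v h1 h2
    rw [(hfd v).deriv, (hkd u).deriv]
    have hd := hle u v h1 h2
    refine le_trans ?_ (mul_le_mul_of_nonneg_right hc (sub_nonneg.2 hd))
    have h3 := sub_rpow_mul_add_le hγ hγ2 (le_max_right (-u) 0) (hmono u v h1 h2)
    have h4 : v - u ≤ max v 0 + max (-u) 0 := by
      linarith [le_max_left v 0, le_max_left (-u) 0]
    have h5 := Real.rpow_le_rpow (le_max_right _ _) (hmono u v h1 h2)
      (by linarith : 0 ≤ γ - 1)
    have h6 := mul_le_mul_of_nonneg_left h4 (sub_nonneg.2 h5)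
    have h7 := mul_le_mul_of_nonneg_left (h6.trans h3) (by linarith : 0 ≤ γ)
    unfold powW
    linarith
  refine ⟨hf, hf.comp contDiff_neg, contDiff_smoothTransition.comp (by fun_prop),
    fun v _ => hfnn v, fun u => hfnn _, fun v => Real.smoothTransition.nonneg _, fun v => ?_, hle,
    hkey 2 hγ2.le, hkey (p - 1) hγp⟩
  refine Antitone.deriv_nonpos fun a b hab => ?_
  exact Real.smoothTransition.monotone (by linarith)

theorem lintegral_powW_mul_le {p γ : ℝ} {φ : ℝ → E3 → ℝ} (hp : 2 < p) (hγ : 1 < γ) (hγ2 : γ < 2)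
    (hγp : γ ≤ p - 1) (hφ : IsNLWSolution p φ) {T : ℝ} (hT : 0 ≤ T) :
    ∫⁻ x : E3, ENNReal.ofReal (powW γ ((T + ‖x‖) / 2) * (|φ T x| ^ (p + 1) / (p + 1)))
      ≤ ∫⁻ x : E3, ENNReal.ofReal (2 * powW γ (‖x‖ / 2) * initD p (fun q => φ q.1 q.2) x) := by
  set D := ∫⁻ x : E3, ENNReal.ofReal (2 * powW γ (‖x‖ / 2) * initD p (fun q => φ q.1 q.2) x)
  have h1 : ∀ n : ℕ, ∫⁻ x : E3, ENNReal.ofReal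
      (outW (powW γ) (fun v => Real.smoothTransition (n + 1 - v)) T ‖x‖
        * (|φ T x| ^ (p + 1) / (p + 1))) ≤ D := fun n =>
    lintegral_outW_mul_le (admissibleWeights_powW hγ hγ2 hγp) hp hφ hT (L := n + 1)
      (fun v hv => Real.smoothTransition.zero_of_nonpos (by linarith))
      (fun v => Real.smoothTransition.le_one _) fun v _ => by rw [neg_neg]
  have hV := continuous_slice (contDiff_potential hp hφ.1).continuous T
  have hf : Continuous (powW γ) := (contDiff_const.add (contDiff_max_rpow hγ)).continuous
  calc ∫⁻ x : E3, ENNReal.ofReal (powW γ ((T + ‖x‖) / 2) * (|φ T x| ^ (p + 1) / (p + 1)))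
      = ∫⁻ x : E3, Filter.liminf (fun n : ℕ => ENNReal.ofReal
          (outW (powW γ) (fun v => Real.smoothTransition (n + 1 - v)) T ‖x‖
            * (|φ T x| ^ (p + 1) / (p + 1)))) Filter.atTop := by
        refine lintegral_congr fun x => ?_
        refine (Filter.Tendsto.liminf_eq (tendsto_const_nhds.congr' ?_)).symm
        filter_upwards [Filter.eventually_ge_atTop ⌈(T + ‖x‖) / 2⌉₊] with n hn
        have h2 : (T + ‖x‖) / 2 ≤ n := (Nat.le_ceil _).trans (by exact_mod_cast hn)
        rw [outW, Real.smoothTransition.one_of_one_le (by linarith), mul_one]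
    _ ≤ Filter.liminf (fun n : ℕ => ∫⁻ x : E3, ENNReal.ofReal
          (outW (powW γ) (fun v => Real.smoothTransition (n + 1 - v)) T ‖x‖
            * (|φ T x| ^ (p + 1) / (p + 1)))) Filter.atTop := by
        refine lintegral_liminf_le fun n => Measurable.ennreal_ofReal ?_
        have hχ := Real.smoothTransition.continuous
        unfold outW
        exact (Continuous.mul (by fun_prop) hV).measurable
    _ ≤ Filter.liminf (fun _ : ℕ => D) Filter.atTop :=
        Filter.liminf_le_liminf (Filter.Eventually.of_forall h1)
    _ = D := Filter.liminf_const D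

/-! ### A weighted Hardy inequality -/

theorem sq_intervalIntegral_le {g : ℝ → ℝ} (hg : Continuous g) :
    (∫ s in (1 : ℝ)..2, g s) ^ 2 ≤ ∫ s in (1 : ℝ)..2, g s ^ 2 := by
  set m := ∫ s in (1 : ℝ)..2, g s with hm
  have h0 : 0 ≤ ∫ s in (1 : ℝ)..2, (g s - m) ^ 2 :=
    intervalIntegral.integral_nonneg one_le_two fun s _ => sq_nonneg _
  have h1 : ∫ s in (1 : ℝ)..2, (g s - m) ^ 2
      = (∫ s in (1 : ℝ)..2, g s ^ 2) - 2 * m * m + m ^ 2 := by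
    have e : ∀ s, (g s - m) ^ 2 = g s ^ 2 - 2 * m * g s + m ^ 2 := fun s => by ring
    simp only [e]
    rw [intervalIntegral.integral_add, intervalIntegral.integral_sub,
      intervalIntegral.integral_const_mul, intervalIntegral.integral_const, ← hm]
    · norm_num
    all_goals exact Continuous.intervalIntegrable (by fun_prop) _ _
  nlinarith

theorem sq_dilation_sub_le {ψ : E3 → ℝ} (hψ : ContDiff ℝ 1 ψ) (x : E3) :
    ENNReal.ofReal ((ψ ((2 : ℝ) • x) - ψ x) ^ 2)
      ≤ ENNReal.ofReal (‖x‖ ^ 2)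
        * ∫⁻ s in Set.Ioc (1 : ℝ) 2, ENNReal.ofReal (‖fderiv ℝ ψ (s • x)‖ ^ 2) := by
  have hc := hψ.continuous_fderiv (by simp)
  have hg : Continuous fun s : ℝ => fderiv ℝ ψ (s • x) x :=
    (hc.comp (by fun_prop)).clm_apply continuous_const
  have hn : Continuous fun s : ℝ => ‖fderiv ℝ ψ (s • x)‖ ^ 2 := (hc.comp (by fun_prop)).norm.pow 2
  have h1 : ∫ s in (1 : ℝ)..2, fderiv ℝ ψ (s • x) x = ψ ((2 : ℝ) • x) - ψ x := by
    have h := intervalIntegral.integral_eq_sub_of_hasDerivAt (a := (1 : ℝ)) (b := 2)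
      (f := fun s : ℝ => ψ (s • x)) (f' := fun s => fderiv ℝ ψ (s • x) x) (fun s _ => ?_)
      (hg.intervalIntegrable _ _)
    · simpa using h
    · have h2 : HasDerivAt (fun s : ℝ => s • x) x s := by
        simpa using (hasDerivAt_id s).smul_const x
      exact ((hψ.differentiable (by simp)) (s • x)).hasFDerivAt.comp_hasDerivAt s h2
  have h2 : (ψ ((2 : ℝ) • x) - ψ x) ^ 2
      ≤ ‖x‖ ^ 2 * ∫ s in (1 : ℝ)..2, ‖fderiv ℝ ψ (s • x)‖ ^ 2 := by
    rw [← h1, ← intervalIntegral.integral_const_mul]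
    refine (sq_intervalIntegral_le hg).trans (intervalIntegral.integral_mono one_le_two
      ((hg.pow 2).intervalIntegrable _ _) ((hn.const_mul _).intervalIntegrable _ _) fun s => ?_)
    have h3 := (fderiv ℝ ψ (s • x)).le_opNorm x
    rw [← mul_pow, ← sq_abs, ← Real.norm_eq_abs]
    exact pow_le_pow_left₀ (norm_nonneg _) (h3.trans_eq (mul_comm _ _)) 2
  refine (ENNReal.ofReal_le_ofReal h2).trans_eq ?_
  rw [ENNReal.ofReal_mul (by positivity), intervalIntegral.integral_of_le one_le_two,
    ofReal_integral_eq_lintegral_ofReal (hn.integrableOn_Icc.mono_set Set.Ioc_subset_Icc_self)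
      (Filter.Eventually.of_forall fun s => by positivity)]

theorem lintegral_comp_smul_E3 {H : E3 → ℝ≥0∞} (hH : Measurable H) {s : ℝ} (hs : 0 < s) :
    ∫⁻ x, H (s • x) = ENNReal.ofReal ((s ^ 3)⁻¹) * ∫⁻ x, H x := by
  rw [← lintegral_map hH (measurable_const_smul s), Measure.map_addHaar_smul _ hs.ne',
    lintegral_smul_measure, smul_eq_mul, finrank_euclideanSpace, Fintype.card_fin,
    abs_of_nonneg (by positivity)]

/-- A regularisation of the weight `(1 + |x|) ^ γ / |x| ^ 2`. -/
def hardyW (γ N : ℝ) (x : E3) : ℝ :=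
  min ((1 + ‖x‖) ^ γ) (N * (1 + ‖x‖) ^ (-(1 / 2) : ℝ)) / (‖x‖ ^ 2 + N⁻¹)

section HardyW

variable {γ N : ℝ}

theorem hardyW_nonneg (hN : 0 < N) (x : E3) : 0 ≤ hardyW γ N x := by
  unfold hardyW
  have : 0 ≤ min ((1 + ‖x‖) ^ γ) (N * (1 + ‖x‖) ^ (-(1 / 2) : ℝ)) := le_min (by positivity)
    (by positivity)
  positivity

theorem continuous_hardyW (hN : 0 < N) : Continuous (hardyW γ N) := by
  have h : ∀ c : ℝ, Continuous fun x : E3 => (1 + ‖x‖) ^ c := fun c =>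
    (continuous_const.add continuous_norm).rpow_const fun x =>
      Or.inl (by positivity : 1 + ‖x‖ ≠ 0)
  unfold hardyW
  exact ((h γ).min ((h _).const_mul N)).div (by fun_prop) fun x =>
    (add_pos_of_nonneg_of_pos (sq_nonneg ‖x‖) (inv_pos.2 hN)).ne'

theorem hardyW_mul_sq_le (hN : 0 < N) (x : E3) : hardyW γ N x * ‖x‖ ^ 2 ≤ (1 + ‖x‖) ^ γ := by
  unfold hardyW
  rw [div_mul_eq_mul_div, div_le_iff₀ (by positivity)]
  have h1 : ‖x‖ ^ 2 ≤ ‖x‖ ^ 2 + N⁻¹ := by linarith [inv_pos.2 hN]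
  exact mul_le_mul (min_le_left _ _) h1 (by positivity) (by positivity)

theorem hardyW_half_le (hγ : 0 ≤ γ) (hN : 0 < N) (x : E3) :
    hardyW γ N ((1 / 2 : ℝ) • x) ≤ 6 * hardyW γ N x := by
  unfold hardyW
  have hn : ‖(1 / 2 : ℝ) • x‖ = ‖x‖ / 2 := by rw [norm_smul]; norm_num; ring
  rw [hn]
  have hx := norm_nonneg x
  have h1 : (1 + ‖x‖ / 2) ^ γ ≤ (1 + ‖x‖) ^ γ := by gcongr; linarith
  have h2 : (1 + ‖x‖ / 2) ^ (-(1 / 2) : ℝ) ≤ 3 / 2 * (1 + ‖x‖) ^ (-(1 / 2) : ℝ) := by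
    have h3 : ((1 + ‖x‖) * (9 / 4)⁻¹) ^ (-(1 / 2) : ℝ) = 3 / 2 * (1 + ‖x‖) ^ (-(1 / 2) : ℝ) := by
      rw [Real.mul_rpow (by positivity) (by norm_num), mul_comm, Real.inv_rpow (by norm_num),
        Real.rpow_neg (by norm_num), inv_inv, ← Real.sqrt_eq_rpow,
        show (9 / 4 : ℝ) = (3 / 2) ^ 2 by norm_num, Real.sqrt_sq (by norm_num)]
    rw [← h3]
    exact Real.rpow_le_rpow_of_nonpos (by positivity) (by linarith) (by norm_num)
  have h4 : min ((1 + ‖x‖ / 2) ^ γ) (N * (1 + ‖x‖ / 2) ^ (-(1 / 2) : ℝ))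
      ≤ 3 / 2 * min ((1 + ‖x‖) ^ γ) (N * (1 + ‖x‖) ^ (-(1 / 2) : ℝ)) := by
    rw [mul_min_of_nonneg _ _ (by norm_num)]
    refine min_le_min (h1.trans ?_) ?_
    · have : 0 ≤ (1 + ‖x‖) ^ γ := by positivity
      linarith
    · calc N * (1 + ‖x‖ / 2) ^ (-(1 / 2) : ℝ) ≤ N * (3 / 2 * (1 + ‖x‖) ^ (-(1 / 2) : ℝ)) := by gcongr
        _ = _ := by ring
  have hmin : 0 ≤ min ((1 + ‖x‖) ^ γ) (N * (1 + ‖x‖) ^ (-(1 / 2) : ℝ)) :=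
    le_min (by positivity) (by positivity)
  calc min ((1 + ‖x‖ / 2) ^ γ) (N * (1 + ‖x‖ / 2) ^ (-(1 / 2) : ℝ)) / ((‖x‖ / 2) ^ 2 + N⁻¹)
      ≤ 3 / 2 * min ((1 + ‖x‖) ^ γ) (N * (1 + ‖x‖) ^ (-(1 / 2) : ℝ)) / ((‖x‖ ^ 2 + N⁻¹) / 4) := by
        have := inv_pos.2 hN
        gcongr
        linarith
    _ = 6 * (min ((1 + ‖x‖) ^ γ) (N * (1 + ‖x‖) ^ (-(1 / 2) : ℝ)) / (‖x‖ ^ 2 + N⁻¹)) := by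
        field_simp
        ring

theorem hardyW_mul_sq_le_add {p y : ℝ} (hp2 : 2 < p) (hp5 : p ≤ 5) (hγ : 0 ≤ γ) (hN : 1 ≤ N)
    (x : E3) :
    hardyW γ N x * y ^ 2 ≤ 2 * N ^ 2
      * ((1 + ‖x‖) ^ γ * |y| ^ (p + 1) + (1 + ‖x‖) ^ (-(15 / 4) : ℝ)) := by
  have hx := norm_nonneg x
  have hb : 1 ≤ 1 + ‖x‖ := by linarith
  have hb0 : 0 < 1 + ‖x‖ := by linarith
  have hN0 : 0 < N := by linarith
  have h1 : hardyW γ N x ≤ 2 * N ^ 2 * (1 + ‖x‖) ^ (-(5 / 2) : ℝ) := by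
    have e : (1 + ‖x‖) ^ (-(5 / 2) : ℝ) = (1 + ‖x‖) ^ (-(1 / 2) : ℝ) * ((1 + ‖x‖) ^ 2)⁻¹ := by
      rw [← Real.rpow_natCast, ← Real.rpow_neg hb0.le, ← Real.rpow_add hb0]
      norm_num
    have h2 : (1 + ‖x‖) ^ 2 ≤ 2 * N * (‖x‖ ^ 2 + N⁻¹) := by
      rw [mul_add, mul_assoc 2 N N⁻¹, mul_inv_cancel₀ hN0.ne']
      nlinarith [sq_nonneg (‖x‖ - 1), mul_le_mul_of_nonneg_right hN (sq_nonneg ‖x‖)]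
    unfold hardyW
    rw [div_le_iff₀ (by positivity), e]
    calc min ((1 + ‖x‖) ^ γ) (N * (1 + ‖x‖) ^ (-(1 / 2) : ℝ))
        ≤ N * (1 + ‖x‖) ^ (-(1 / 2) : ℝ) * (((1 + ‖x‖) ^ 2)⁻¹ * (1 + ‖x‖) ^ 2) := by
          rw [inv_mul_cancel₀ (by positivity), mul_one]
          exact min_le_right _ _
      _ ≤ N * (1 + ‖x‖) ^ (-(1 / 2) : ℝ) * (((1 + ‖x‖) ^ 2)⁻¹ * (2 * N * (‖x‖ ^ 2 + N⁻¹))) := by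
          gcongr
      _ = _ := by ring
  have h3 : (1 + ‖x‖) ^ (-(5 / 2) : ℝ) * y ^ 2
      ≤ (1 + ‖x‖) ^ γ * |y| ^ (p + 1) + (1 + ‖x‖) ^ (-(15 / 4) : ℝ) := by
    have hone : 1 ≤ (1 + ‖x‖) ^ γ := Real.one_le_rpow hb hγ
    rcases le_or_gt ((1 + ‖x‖) ^ (-(5 / 2) : ℝ)) (|y| ^ (p - 1)) with h | h
    · have h4 : (1 + ‖x‖) ^ (-(5 / 2) : ℝ) * y ^ 2 ≤ |y| ^ (p + 1) := by
        have e : |y| ^ (p + 1) = |y| ^ (p - 1) * y ^ 2 := by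
          rw [← sq_abs, ← Real.rpow_natCast, ← Real.rpow_add' (abs_nonneg y)]
          · norm_num; ring_nf
          · norm_num; linarith
        rw [e]
        gcongr
      have h5 : |y| ^ (p + 1) ≤ (1 + ‖x‖) ^ γ * |y| ^ (p + 1) :=
        le_mul_of_one_le_left (by positivity) hone
      linarith [Real.rpow_nonneg hb0.le (-(15 / 4) : ℝ)]
    · have hq : 0 < p - 1 := by linarith
      have h4 : y ^ 2 ≤ (1 + ‖x‖) ^ (-(5 / 4) : ℝ) := by
        have e : y ^ 2 = (|y| ^ (p - 1)) ^ (2 / (p - 1)) := by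
          rw [← Real.rpow_mul (abs_nonneg y), mul_div_cancel₀ _ hq.ne', ← sq_abs,
            ← Real.rpow_natCast]
          norm_num
        rw [e]
        refine (Real.rpow_le_rpow (by positivity) h.le (by positivity)).trans ?_
        rw [← Real.rpow_mul hb0.le]
        refine Real.rpow_le_rpow_of_exponent_le hb ?_
        have : 1 / 2 ≤ 2 / (p - 1) := by rw [div_le_div_iff₀ two_pos hq]; linarith
        linarith
      have e : (1 + ‖x‖) ^ (-(15 / 4) : ℝ)
          = (1 + ‖x‖) ^ (-(5 / 2) : ℝ) * (1 + ‖x‖) ^ (-(5 / 4) : ℝ) := by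
        rw [← Real.rpow_add hb0]; norm_num
      have h5 : (1 + ‖x‖) ^ (-(5 / 2) : ℝ) * y ^ 2 ≤ (1 + ‖x‖) ^ (-(15 / 4) : ℝ) := by
        rw [e]; gcongr
      have : 0 ≤ (1 + ‖x‖) ^ γ * |y| ^ (p + 1) := by positivity
      linarith
  calc hardyW γ N x * y ^ 2 ≤ 2 * N ^ 2 * (1 + ‖x‖) ^ (-(5 / 2) : ℝ) * y ^ 2 := by gcongr
    _ = 2 * N ^ 2 * ((1 + ‖x‖) ^ (-(5 / 2) : ℝ) * y ^ 2) := by ring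
    _ ≤ _ := by gcongr

end HardyW

theorem lintegral_hardyW_le {γ N p : ℝ} {ψ : E3 → ℝ} (hp2 : 2 < p) (hp5 : p ≤ 5) (hγ : 0 ≤ γ)
    (hN : 1 ≤ N) (hψ : ContDiff ℝ 1 ψ)
    (hfin : ∫⁻ x : E3, ENNReal.ofReal ((1 + ‖x‖) ^ γ * |ψ x| ^ (p + 1)) < ⊤) :
    ∫⁻ x : E3, ENNReal.ofReal (hardyW γ N x * ψ x ^ 2)
      ≤ 56 * ∫⁻ x : E3, ENNReal.ofReal ((1 + ‖x‖) ^ γ * ‖fderiv ℝ ψ x‖ ^ 2) := by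
  have hN0 : 0 < N := by linarith
  set I := ∫⁻ x : E3, ENNReal.ofReal (hardyW γ N x * ψ x ^ 2) with hI
  set G := ∫⁻ x : E3, ENNReal.ofReal ((1 + ‖x‖) ^ γ * ‖fderiv ℝ ψ x‖ ^ 2) with hG
  have hw := continuous_hardyW (γ := γ) hN0
  have hw0 := hardyW_nonneg (γ := γ) hN0
  have hD := hψ.continuous_fderiv (by simp)
  have hψc := hψ.continuous
  have hpow : ∀ c : ℝ, Continuous fun x : E3 => (1 + ‖x‖) ^ c := fun c =>
    (continuous_const.add continuous_norm).rpow_const fun x =>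
      Or.inl (by positivity : 1 + ‖x‖ ≠ 0)
  have hIfin : I < ⊤ := by
    have h1 : I ≤ ENNReal.ofReal (2 * N ^ 2)
        * ((∫⁻ x : E3, ENNReal.ofReal ((1 + ‖x‖) ^ γ * |ψ x| ^ (p + 1)))
          + ∫⁻ x : E3, ENNReal.ofReal ((1 + ‖x‖) ^ (-(15 / 4) : ℝ))) := by
      rw [← lintegral_add_right _ (hpow _).measurable.ennreal_ofReal,
        ← lintegral_const_mul' _ _ ENNReal.ofReal_ne_top]
      refine lintegral_mono fun x => ?_
      rw [← ENNReal.ofReal_add (by positivity) (by positivity), ← ENNReal.ofReal_mul (by positivity)]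
      exact ENNReal.ofReal_le_ofReal (hardyW_mul_sq_le_add hp2 hp5 hγ hN x)
    refine h1.trans_lt (ENNReal.mul_lt_top ENNReal.ofReal_lt_top (ENNReal.add_lt_top.2 ⟨hfin, ?_⟩))
    exact finite_integral_one_add_norm (by simp; norm_num)
  have hscale : ∫⁻ x : E3, ENNReal.ofReal (hardyW γ N x * ψ ((2 : ℝ) • x) ^ 2)
      ≤ ENNReal.ofReal (3 / 4) * I := by
    have h1 : Measurable fun y : E3 => ENNReal.ofReal (hardyW γ N ((1 / 2 : ℝ) • y) * ψ y ^ 2) :=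
      Measurable.ennreal_ofReal (Continuous.measurable (by fun_prop))
    have h2 := lintegral_comp_smul_E3 h1 two_pos
    simp only [smul_smul] at h2
    norm_num only [one_smul] at h2
    rw [h2]
    calc ENNReal.ofReal (1 / 8)
          * ∫⁻ y : E3, ENNReal.ofReal (hardyW γ N ((1 / 2 : ℝ) • y) * ψ y ^ 2)
        ≤ ENNReal.ofReal (1 / 8) * ∫⁻ y : E3, ENNReal.ofReal 6
            * ENNReal.ofReal (hardyW γ N y * ψ y ^ 2) := by
          gcongr with y
          rw [← ENNReal.ofReal_mul (by norm_num), ← mul_assoc]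
          exact ENNReal.ofReal_le_ofReal
            (mul_le_mul_of_nonneg_right (hardyW_half_le hγ hN0 y) (sq_nonneg _))
      _ = ENNReal.ofReal (3 / 4) * I := by
          rw [lintegral_const_mul' _ _ ENNReal.ofReal_ne_top, ← mul_assoc,
            ← ENNReal.ofReal_mul (by norm_num), ← hI]
          norm_num
  have hdiff : ∫⁻ x : E3, ENNReal.ofReal (hardyW γ N x * (ψ ((2 : ℝ) • x) - ψ x) ^ 2) ≤ G := by
    have hm : Measurable fun y : E3 => ENNReal.ofReal ((1 + ‖y‖) ^ γ * ‖fderiv ℝ ψ y‖ ^ 2) :=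
      ((hpow γ).mul (hD.norm.pow 2)).measurable.ennreal_ofReal
    calc ∫⁻ x : E3, ENNReal.ofReal (hardyW γ N x * (ψ ((2 : ℝ) • x) - ψ x) ^ 2)
        ≤ ∫⁻ x : E3, ∫⁻ s in Set.Ioc (1 : ℝ) 2,
            ENNReal.ofReal ((1 + ‖s • x‖) ^ γ * ‖fderiv ℝ ψ (s • x)‖ ^ 2) := by
          refine lintegral_mono fun x => ?_
          rw [ENNReal.ofReal_mul (hw0 x)]
          refine (mul_le_mul_right (sq_dilation_sub_le hψ x) _).trans ?_
          rw [← mul_assoc, ← ENNReal.ofReal_mul (hw0 x),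
            ← lintegral_const_mul' _ _ ENNReal.ofReal_ne_top]
          refine setLIntegral_mono' measurableSet_Ioc fun s hs => ?_
          rw [← ENNReal.ofReal_mul (mul_nonneg (hw0 x) (sq_nonneg _))]
          refine ENNReal.ofReal_le_ofReal (mul_le_mul_of_nonneg_right ?_ (sq_nonneg _))
          refine (hardyW_mul_sq_le hN0 x).trans (Real.rpow_le_rpow (by positivity) ?_ hγ)
          rw [norm_smul, Real.norm_eq_abs, abs_of_pos (by linarith [hs.1])]
          linarith [le_mul_of_one_le_left (norm_nonneg x) hs.1.le]
      _ = ∫⁻ s in Set.Ioc (1 : ℝ) 2, ∫⁻ x : E3,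
            ENNReal.ofReal ((1 + ‖s • x‖) ^ γ * ‖fderiv ℝ ψ (s • x)‖ ^ 2) := by
          refine lintegral_lintegral_swap (Measurable.aemeasurable ?_)
          exact hm.comp (by fun_prop : Measurable fun q : E3 × ℝ => q.2 • q.1)
      _ ≤ ∫⁻ _ in Set.Ioc (1 : ℝ) 2, G := by
          refine setLIntegral_mono' measurableSet_Ioc fun s hs => ?_
          rw [lintegral_comp_smul_E3 hm (by linarith [hs.1])]
          refine mul_le_of_le_one_left' ?_
          rw [ENNReal.ofReal_le_one]
          exact inv_le_one_of_one_le₀ (one_le_pow₀ hs.1.le)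
      _ = G := by
          rw [setLIntegral_const, Real.volume_Ioc]
          norm_num
  have hm2 : Measurable fun x : E3 =>
      ENNReal.ofReal (hardyW γ N x * ψ ((2 : ℝ) • x) ^ 2) :=
    Measurable.ennreal_ofReal (Continuous.measurable (by fun_prop))
  have hsum : I ≤ ENNReal.ofReal (7 / 8) * I + 7 * G := by
    calc I ≤ ∫⁻ x : E3, (ENNReal.ofReal (7 / 6)
              * ENNReal.ofReal (hardyW γ N x * ψ ((2 : ℝ) • x) ^ 2)
            + ENNReal.ofReal 7
              * ENNReal.ofReal (hardyW γ N x * (ψ ((2 : ℝ) • x) - ψ x) ^ 2)) := by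
          refine lintegral_mono fun x => ?_
          have h0 := hw0 x
          rw [← ENNReal.ofReal_mul (by norm_num), ← ENNReal.ofReal_mul (by norm_num),
            ← ENNReal.ofReal_add (by positivity) (by positivity)]
          refine ENNReal.ofReal_le_ofReal ?_
          have h1 : ψ x ^ 2 ≤ 7 / 6 * ψ ((2 : ℝ) • x) ^ 2 + 7 * (ψ ((2 : ℝ) • x) - ψ x) ^ 2 := by
            nlinarith [sq_nonneg (7 * ψ ((2 : ℝ) • x) - 6 * ψ x)]
          calc hardyW γ N x * ψ x ^ 2 ≤ hardyW γ N x
                * (7 / 6 * ψ ((2 : ℝ) • x) ^ 2 + 7 * (ψ ((2 : ℝ) • x) - ψ x) ^ 2) := by gcongr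
            _ = _ := by ring
      _ = ENNReal.ofReal (7 / 6)
              * (∫⁻ x : E3, ENNReal.ofReal (hardyW γ N x * ψ ((2 : ℝ) • x) ^ 2))
            + ENNReal.ofReal 7
              * ∫⁻ x : E3, ENNReal.ofReal (hardyW γ N x * (ψ ((2 : ℝ) • x) - ψ x) ^ 2) := by
          rw [lintegral_add_left (hm2.const_mul _),
            lintegral_const_mul' _ _ ENNReal.ofReal_ne_top,
            lintegral_const_mul' _ _ ENNReal.ofReal_ne_top]
      _ ≤ ENNReal.ofReal (7 / 6) * (ENNReal.ofReal (3 / 4) * I) + ENNReal.ofReal 7 * G := by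
          gcongr
      _ = ENNReal.ofReal (7 / 8) * I + 7 * G := by
          rw [← mul_assoc, ← ENNReal.ofReal_mul (by norm_num)]
          norm_num
  have h8 : ENNReal.ofReal (1 / 8) * I ≤ 7 * G := by
    have h9 : I = ENNReal.ofReal (7 / 8) * I + ENNReal.ofReal (1 / 8) * I := by
      rw [← add_mul, ← ENNReal.ofReal_add (by norm_num) (by norm_num)]
      norm_num
    have h10 : ENNReal.ofReal (7 / 8) * I ≠ ⊤ :=
      (ENNReal.mul_lt_top ENNReal.ofReal_lt_top hIfin).ne
    exact (ENNReal.add_le_add_iff_left h10).1 (h9 ▸ hsum)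
  calc I = 8 * (ENNReal.ofReal (1 / 8) * I) := by
        rw [← mul_assoc, ← ENNReal.ofReal_ofNat, ← ENNReal.ofReal_mul (by norm_num)]
        norm_num
    _ ≤ 8 * (7 * G) := by gcongr
    _ = 56 * G := by rw [← mul_assoc]; norm_num

theorem lintegral_rpow_mul_sq_div_le {γ p : ℝ} {ψ : E3 → ℝ} (hp2 : 2 < p) (hp5 : p ≤ 5)
    (hγ : 0 ≤ γ) (hψ : ContDiff ℝ 1 ψ)
    (hfin : ∫⁻ x : E3, ENNReal.ofReal ((1 + ‖x‖) ^ γ * |ψ x| ^ (p + 1)) < ⊤) :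
    ∫⁻ x : E3, ENNReal.ofReal ((1 + ‖x‖) ^ γ * (ψ x ^ 2 / ‖x‖ ^ 2))
      ≤ 56 * ∫⁻ x : E3, ENNReal.ofReal ((1 + ‖x‖) ^ γ * ‖fderiv ℝ ψ x‖ ^ 2) := by
  set D := 56 * ∫⁻ x : E3, ENNReal.ofReal ((1 + ‖x‖) ^ γ * ‖fderiv ℝ ψ x‖ ^ 2)
  have hne : ∀ᵐ x : E3, x ≠ 0 := compl_mem_ae_iff.2 (measure_singleton 0)
  calc ∫⁻ x : E3, ENNReal.ofReal ((1 + ‖x‖) ^ γ * (ψ x ^ 2 / ‖x‖ ^ 2))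
      = ∫⁻ x : E3, Filter.liminf (fun n : ℕ =>
          ENNReal.ofReal (hardyW γ (n + 1) x * ψ x ^ 2)) Filter.atTop := by
        refine lintegral_congr_ae ?_
        filter_upwards [hne] with x hx
        have hr : 0 < ‖x‖ := norm_pos_iff.2 hx
        refine (Filter.Tendsto.liminf_eq (ENNReal.tendsto_ofReal ?_)).symm
        have h1 : Filter.Tendsto (fun n : ℕ => (1 + ‖x‖) ^ γ / (‖x‖ ^ 2 + ((n : ℝ) + 1)⁻¹) * ψ x ^ 2)
            Filter.atTop (nhds ((1 + ‖x‖) ^ γ / (‖x‖ ^ 2 + 0) * ψ x ^ 2)) := by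
          have h2 : Filter.Tendsto (fun n : ℕ => ((n : ℝ) + 1)⁻¹) Filter.atTop (nhds 0) := by
            simpa using tendsto_one_div_add_atTop_nhds_zero_nat (𝕜 := ℝ)
          exact (tendsto_const_nhds.div (h2.const_add _) (by positivity)).mul_const _
        have h3 : (1 + ‖x‖) ^ γ / (‖x‖ ^ 2 + 0) * ψ x ^ 2
            = (1 + ‖x‖) ^ γ * (ψ x ^ 2 / ‖x‖ ^ 2) := by rw [add_zero]; ring
        rw [← h3]
        refine h1.congr' ?_
        filter_upwards [Filter.eventually_ge_atTop ⌈(1 + ‖x‖) ^ γ / (1 + ‖x‖) ^ (-(1 / 2) : ℝ)⌉₊]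
          with n hn
        have h4 : (1 + ‖x‖) ^ γ / (1 + ‖x‖) ^ (-(1 / 2) : ℝ) ≤ n :=
          (Nat.le_ceil _).trans (by exact_mod_cast hn)
        rw [hardyW, min_eq_left]
        rw [div_le_iff₀ (by positivity)] at h4
        refine h4.trans ?_
        gcongr
        linarith
    _ ≤ Filter.liminf (fun n : ℕ => ∫⁻ x : E3,
          ENNReal.ofReal (hardyW γ (n + 1) x * ψ x ^ 2)) Filter.atTop :=
        lintegral_liminf_le fun n =>
          ((continuous_hardyW (by positivity)).mul (hψ.continuous.pow 2)).measurable.ennreal_ofReal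
    _ ≤ Filter.liminf (fun _ : ℕ => D) Filter.atTop :=
        Filter.liminf_le_liminf (Filter.Eventually.of_forall fun n =>
          lintegral_hardyW_le hp2 hp5 hγ (by linarith [(Nat.cast_nonneg n : (0 : ℝ) ≤ n)]) hψ hfin)
    _ = D := Filter.liminf_const D

theorem initD_le {p : ℝ} {φ : ℝ → E3 → ℝ} (hp : 2 < p)
    (hφ : ContDiff ℝ (⊤ : ℕ∞) fun q : ℝ × E3 => φ q.1 q.2) (x : E3) :
    initD p (fun q => φ q.1 q.2) x ≤ dt1 φ 0 x ^ 2 + 3 * ‖fderiv ℝ (φ 0) x‖ ^ 2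
      + φ 0 x ^ 2 / ‖x‖ ^ 2 + |φ 0 x| ^ (p + 1) := by
  have hd : DifferentiableAt ℝ (fun q : ℝ × E3 => φ q.1 q.2) (0, x) :=
    (hφ.differentiable (by simp)).differentiableAt
  have h1 : dt1 φ 0 x = pd dirT (fun q : ℝ × E3 => φ q.1 q.2) (0, x) := pd_dirT hd
  have h2 : ∀ j : Fin 3, pd (dirX j) (fun q : ℝ × E3 => φ q.1 q.2) (0, x) ^ 2
      ≤ ‖fderiv ℝ (φ 0) x‖ ^ 2 := fun j => by
    have h3 := fderiv_slice hd (EuclideanSpace.single j 1)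
    have h4 := (fderiv ℝ (φ 0) x).le_opNorm (EuclideanSpace.single j 1)
    rw [PiLp.norm_single, norm_one, mul_one] at h4
    have h5 : pd (dirX j) (fun q : ℝ × E3 => φ q.1 q.2) (0, x)
        = fderiv ℝ (φ 0) x (EuclideanSpace.single j 1) := h3.symm
    rw [h5, ← sq_abs]
    exact pow_le_pow_left₀ (abs_nonneg _) h4 2
  have h6 : |φ 0 x| ^ (p + 1) / (p + 1) ≤ |φ 0 x| ^ (p + 1) :=
    div_le_self (by positivity) (by linarith)
  have h7 := Finset.sum_le_sum fun j (_ : j ∈ Finset.univ) => h2 j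
  simp only [Finset.sum_const, Finset.card_univ, Fintype.card_fin, nsmul_eq_mul] at h7
  push_cast at h7
  rw [initD, h1]
  linarith

theorem wEnergy_zero (p γ : ℝ) (φ : ℝ → E3 → ℝ) :
    wEnergy p 0 γ φ = (∫⁻ x : E3, ENNReal.ofReal
        ((1 + ‖x‖) ^ γ * (‖fderiv ℝ (φ 0) x‖ ^ 2 + dt1 φ 0 x ^ 2)))
      + ∫⁻ x : E3, ENNReal.ofReal ((1 + ‖x‖) ^ γ * |φ 0 x| ^ (p + 1)) := by
  have h : ∀ x, ‖iteratedFDeriv ℝ 1 (φ 0) x‖ = ‖fderiv ℝ (φ 0) x‖ := fun x =>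
    norm_iteratedFDeriv_one ..
  simp [wEnergy, h]

theorem powW_half_le {γ r : ℝ} (hγ : 0 ≤ γ) (hr : 0 ≤ r) :
    2 * powW γ (r / 2) ≤ 4 * (1 + r) ^ γ := by
  rw [powW_of_nonneg (by positivity)]
  have h1 : (r / 2) ^ γ ≤ (1 + r) ^ γ :=
    Real.rpow_le_rpow (by positivity) (by linarith) hγ
  have h2 : 1 ≤ (1 + r) ^ γ := Real.one_le_rpow (by linarith) hγ
  linarith

theorem lintegral_initD_le {p γ : ℝ} {φ : ℝ → E3 → ℝ} (hp2 : 2 < p) (hp5 : p ≤ 5)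
    (hγ : 0 ≤ γ) (hφ : ContDiff ℝ (⊤ : ℕ∞) fun q : ℝ × E3 => φ q.1 q.2)
    (hfin : wEnergy p 0 γ φ < ⊤) :
    ∫⁻ x : E3, ENNReal.ofReal (2 * powW γ (‖x‖ / 2) * initD p (fun q => φ q.1 q.2) x)
      ≤ 240 * wEnergy p 0 γ φ := by
  have hψ : ContDiff ℝ (⊤ : ℕ∞) (φ 0) := hφ.comp (contDiff_prodMk_right (0 : ℝ))
  have hpow : Continuous fun x : E3 => (1 + ‖x‖) ^ γ :=
    (continuous_const.add continuous_norm).rpow_const fun x =>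
      Or.inl (by positivity : 1 + ‖x‖ ≠ 0)
  rw [wEnergy_zero] at hfin ⊢
  set A := ∫⁻ x : E3, ENNReal.ofReal
    ((1 + ‖x‖) ^ γ * (‖fderiv ℝ (φ 0) x‖ ^ 2 + dt1 φ 0 x ^ 2)) with hA
  set B := ∫⁻ x : E3, ENNReal.ofReal ((1 + ‖x‖) ^ γ * |φ 0 x| ^ (p + 1)) with hB
  have hH : ∫⁻ x : E3, ENNReal.ofReal ((1 + ‖x‖) ^ γ * (φ 0 x ^ 2 / ‖x‖ ^ 2)) ≤ 56 * A := by
    refine (lintegral_rpow_mul_sq_div_le hp2 hp5 hγ (hψ.of_le (by simp))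
      (ENNReal.add_lt_top.1 hfin).2).trans ?_
    gcongr
    rw [hA]
    gcongr with x
    linarith [sq_nonneg (dt1 φ 0 x)]
  have hmB : Measurable fun x : E3 => ENNReal.ofReal ((1 + ‖x‖) ^ γ * |φ 0 x| ^ (p + 1)) :=
    (hpow.mul (hψ.continuous.abs.rpow_const fun x =>
      Or.inr (by linarith))).measurable.ennreal_ofReal
  have hmH : Measurable fun x : E3 => ENNReal.ofReal ((1 + ‖x‖) ^ γ * (φ 0 x ^ 2 / ‖x‖ ^ 2)) :=
    (hpow.measurable.mul ((hψ.continuous.pow 2).measurable.div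
      (continuous_norm.pow 2).measurable)).ennreal_ofReal
  calc ∫⁻ x : E3, ENNReal.ofReal (2 * powW γ (‖x‖ / 2) * initD p (fun q => φ q.1 q.2) x)
      ≤ ∫⁻ x : E3, 4 * ((3 * ENNReal.ofReal
          ((1 + ‖x‖) ^ γ * (‖fderiv ℝ (φ 0) x‖ ^ 2 + dt1 φ 0 x ^ 2))
          + ENNReal.ofReal ((1 + ‖x‖) ^ γ * |φ 0 x| ^ (p + 1)))
          + ENNReal.ofReal ((1 + ‖x‖) ^ γ * (φ 0 x ^ 2 / ‖x‖ ^ 2))) := by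
        refine lintegral_mono fun x => ?_
        have h1 := initD_le hp2 hφ x
        have h2 := powW_half_le hγ (norm_nonneg x)
        have h3 : (0 : ℝ) ≤ (1 + ‖x‖) ^ γ := by positivity
        simp only
        rw [← ENNReal.ofReal_ofNat 3, ← ENNReal.ofReal_ofNat 4,
          ← ENNReal.ofReal_mul (by norm_num), ← ENNReal.ofReal_add (by positivity) (by positivity),
          ← ENNReal.ofReal_add (by positivity) (by positivity), ← ENNReal.ofReal_mul (by norm_num)]
        refine ENNReal.ofReal_le_ofReal ?_
        have h4 := mul_le_mul h2 h1 (initD_nonneg (by linarith) x) (by positivity)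
        refine h4.trans ?_
        have h5 := mul_nonneg h3 (sq_nonneg (dt1 φ 0 x))
        linarith
    _ = 4 * ((3 * A + B) + ∫⁻ x : E3, ENNReal.ofReal ((1 + ‖x‖) ^ γ * (φ 0 x ^ 2 / ‖x‖ ^ 2))) := by
        rw [lintegral_const_mul' _ _ (by simp), lintegral_add_right _ hmH,
          lintegral_add_right _ hmB, lintegral_const_mul' _ _ (by simp)]
    _ ≤ 4 * ((3 * A + B) + 56 * A) := by gcongr
    _ = 236 * A + 4 * B := by ring
    _ ≤ 240 * A + 240 * B := by gcongr <;> norm_num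
    _ = 240 * (A + B) := by ring

theorem vplus_rpow_le {γ ε t r : ℝ} (hγ : 0 ≤ γ) (hγ2 : γ ≤ 2) (hε : 0 ≤ ε) (ht : 0 ≤ t)
    (hr : 0 ≤ r) :
    vplus t r ^ (γ - ε - 1)
      ≤ 4 * 3 ^ (1 + ε) * (1 + t) ^ (-(1 + ε)) * powW γ ((t + r) / 2) := by
  set v := (t + r) / 2 with hv
  have hv0 : 0 ≤ v := by positivity
  have htv : t ≤ 2 * v := by rw [hv]; linarith
  have hV1 : vplus t r ≤ 1 + v := by
    rw [vplus, Real.sqrt_le_left (by positivity)]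
    nlinarith
  have hV2 : (1 + t) / 3 ≤ vplus t r := by
    refine Real.le_sqrt_of_sq_le ?_
    rw [← hv]
    nlinarith [sq_nonneg (v - 2)]
  have hV0 : 0 < vplus t r := lt_of_lt_of_le (by positivity) hV2
  have h1 : vplus t r ^ γ ≤ 4 * powW γ v := by
    rw [powW_of_nonneg hv0]
    refine (Real.rpow_le_rpow hV0.le hV1 hγ).trans ?_
    have h4 : (2 : ℝ) ^ γ ≤ 4 := by
      calc (2 : ℝ) ^ γ ≤ 2 ^ (2 : ℝ) := Real.rpow_le_rpow_of_exponent_le (by norm_num) hγ2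
        _ = 4 := by norm_num
    have hvγ : 0 ≤ v ^ γ := by positivity
    rcases le_total v 1 with h | h
    · have : (1 + v) ^ γ ≤ 2 ^ γ := Real.rpow_le_rpow (by positivity) (by linarith) hγ
      linarith
    · have : (1 + v) ^ γ ≤ (2 * v) ^ γ := Real.rpow_le_rpow (by positivity) (by linarith) hγ
      rw [Real.mul_rpow (by norm_num) hv0] at this
      nlinarith
  have h2 : vplus t r ^ (-(1 + ε)) ≤ 3 ^ (1 + ε) * (1 + t) ^ (-(1 + ε)) := by
    refine (Real.rpow_le_rpow_of_nonpos (by positivity) hV2 (by linarith)).trans_eq ?_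
    rw [Real.div_rpow (by positivity) (by norm_num), Real.rpow_neg (by norm_num : (0 : ℝ) ≤ 3),
      div_inv_eq_mul, mul_comm]
  calc vplus t r ^ (γ - ε - 1) = vplus t r ^ γ * vplus t r ^ (-(1 + ε)) := by
        rw [← Real.rpow_add hV0]; ring_nf
    _ ≤ (4 * powW γ v) * (3 ^ (1 + ε) * (1 + t) ^ (-(1 + ε))) :=
        mul_le_mul h1 h2 (by positivity) (le_trans (by positivity) h1)
    _ = _ := by ring

theorem lintegral_Ioi_one_add_rpow_lt_top {ε : ℝ} (hε : 0 < ε) :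
    ∫⁻ t in Set.Ioi (0 : ℝ), ENNReal.ofReal ((1 + t) ^ (-(1 + ε))) < ⊤ := by
  have h : ∫⁻ t : ℝ, ENNReal.ofReal ((1 + ‖t‖) ^ (-(1 + ε))) < ⊤ :=
    finite_integral_one_add_norm (by simp [hε])
  refine lt_of_le_of_lt ?_ h
  refine le_trans (setLIntegral_mono' measurableSet_Ioi fun t ht => ?_)
    (setLIntegral_le_lintegral (Set.Ioi 0) _)
  rw [Real.norm_of_nonneg (le_of_lt ht)]

/-- Uniform weighted spacetime bound for the defocusing semilinear
wave equation: for `2 < p ≤ 5`, `1 < γ₀ < min{2, p−1}` and `0 < ε < γ₀ − 1`, there is a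
constant `C > 0` depending only on `p`, `ε`, `γ₀` such that every smooth solution with
finite weighted energy satisfies
`∫₀^∞ ∫_{ℝ³} v₊^{γ₀−ε−1} |φ|^{p+1} dx dt ≤ C ⬝ E_{0,γ₀}[φ]`. -/
theorem nlw_spacetime_bound (p γ₀ ε : ℝ) (hp2 : 2 < p) (hp5 : p ≤ 5)
    (hγ₁ : 1 < γ₀) (hγ₂ : γ₀ < min 2 (p - 1)) (hε₀ : 0 < ε) (hε₁ : ε < γ₀ - 1) :
    ∃ C : ℝ, 0 < C ∧ ∀ φ : ℝ → E3 → ℝ, IsNLWSolution p φ →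
      wEnergy p 0 γ₀ φ < ⊤ →
      (∫⁻ t in Set.Ioi (0 : ℝ), ∫⁻ x : E3,
          ENNReal.ofReal (vplus t ‖x‖ ^ (γ₀ - ε - 1) * |φ t x| ^ (p + 1)))
        ≤ ENNReal.ofReal C * wEnergy p 0 γ₀ φ := by
  obtain ⟨hγ3, hγ4⟩ := lt_min_iff.1 hγ₂
  set K : ℝ := 4 * 3 ^ (1 + ε) * (p + 1) with hK
  have hK0 : 0 < K := by positivity
  set J := ∫⁻ t in Set.Ioi (0 : ℝ), ENNReal.ofReal ((1 + t) ^ (-(1 + ε))) with hJ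
  have hJfin : J < ⊤ := lintegral_Ioi_one_add_rpow_lt_top hε₀
  refine ⟨K * 240 * (J.toReal + 1), by positivity, fun φ hφ hE => ?_⟩
  have hslice : ∀ t ∈ Set.Ioi (0 : ℝ), ∫⁻ x : E3,
      ENNReal.ofReal (vplus t ‖x‖ ^ (γ₀ - ε - 1) * |φ t x| ^ (p + 1))
      ≤ ENNReal.ofReal ((1 + t) ^ (-(1 + ε)))
        * (ENNReal.ofReal (K * 240) * wEnergy p 0 γ₀ φ) := by
    intro t ht
    have ht0 : 0 ≤ t := le_of_lt ht
    calc ∫⁻ x : E3, ENNReal.ofReal (vplus t ‖x‖ ^ (γ₀ - ε - 1) * |φ t x| ^ (p + 1))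
        ≤ ∫⁻ x : E3, ENNReal.ofReal ((1 + t) ^ (-(1 + ε)) * K)
            * ENNReal.ofReal (powW γ₀ ((t + ‖x‖) / 2) * (|φ t x| ^ (p + 1) / (p + 1))) := by
          refine lintegral_mono fun x => ?_
          rw [← ENNReal.ofReal_mul (by positivity)]
          refine ENNReal.ofReal_le_ofReal ?_
          refine (mul_le_mul_of_nonneg_right (vplus_rpow_le (by linarith) hγ3.le hε₀.le ht0
            (norm_nonneg x)) (by positivity)).trans_eq ?_
          rw [hK]
          field_simp
      _ ≤ ENNReal.ofReal ((1 + t) ^ (-(1 + ε)) * K) * (240 * wEnergy p 0 γ₀ φ) := by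
          rw [lintegral_const_mul' _ _ ENNReal.ofReal_ne_top]
          gcongr
          exact (lintegral_powW_mul_le hp2 hγ₁ hγ3 hγ4.le hφ ht0).trans
            (lintegral_initD_le hp2 hp5 (by linarith) hφ.1 hE)
      _ = _ := by
          rw [ENNReal.ofReal_mul (by positivity), ENNReal.ofReal_mul hK0.le,
            ENNReal.ofReal_ofNat]
          ring
  calc ∫⁻ t in Set.Ioi (0 : ℝ), ∫⁻ x : E3,
        ENNReal.ofReal (vplus t ‖x‖ ^ (γ₀ - ε - 1) * |φ t x| ^ (p + 1))
      ≤ ∫⁻ t in Set.Ioi (0 : ℝ), ENNReal.ofReal ((1 + t) ^ (-(1 + ε)))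
          * (ENNReal.ofReal (K * 240) * wEnergy p 0 γ₀ φ) :=
        setLIntegral_mono' measurableSet_Ioi hslice
    _ = J * (ENNReal.ofReal (K * 240) * wEnergy p 0 γ₀ φ) :=
        lintegral_mul_const' _ _ (ENNReal.mul_lt_top ENNReal.ofReal_lt_top hE).ne
    _ ≤ ENNReal.ofReal (J.toReal + 1) * (ENNReal.ofReal (K * 240) * wEnergy p 0 γ₀ φ) := by
        gcongr
        rw [ENNReal.le_ofReal_iff_toReal_le hJfin.ne (by positivity)]
        linarith
    _ = _ := by
        rw [ENNReal.ofReal_mul (by positivity : (0 : ℝ) ≤ K * 240)]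
        ring
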